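/- arXiv:2304.04855 — 5 statements merged into one kernel-verified Lean document; each statement's English description precedes it below -/
import Mathlib

section
/- For every integer k ≥ 2 there exist a constant c > 0 and an integer q₀ such that for every integer q ≥ q₀ and every integer e with (50q)^k < e < 2^q, there exists a (q,k)-system consisting of exactly e q-cliques whose chromatic number is at least c · e^{1/k} · q. -/
/-- `𝒜` is a family of `q`-element vertex sets (`q`-cliques) that pairwise share at most `ℓ`
vertices.  The associated `k`-uniform hypergraph (an `ℓ`-`(q,k)`-system) has as edges all
`k`-element subsets of members of `𝒜`. -/
def IsSystem {V : Type*} [DecidableEq V] (ℓ q : ℕ) (𝒜 : Finset (Finset V)) : Prop :=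
  (∀ A ∈ 𝒜, A.card = q) ∧
    ∀ A ∈ 𝒜, ∀ B ∈ 𝒜, A ≠ B → (A ∩ B).card ≤ ℓ

/-- The `k`-uniform hypergraph whose edges are all `k`-element subsets of members of `𝒜`
admits a proper coloring with `n` colors: no edge is monochromatic. -/
def SysColorable {V : Type*} (k n : ℕ) (𝒜 : Finset (Finset V)) : Prop :=
  ∃ χ : V → Fin n, ∀ A ∈ 𝒜, ∀ S ⊆ A, S.card = k → ∃ u ∈ S, ∃ w ∈ S, χ u ≠ χ w

open Finset in
/-- A random translation argument: if `|ι| · C(|X|, q) · |D| ^ q < |F| ^ q`, some function `s`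
has the property that for no `a` the difference `φ a - s` hits `D` at `q` or more points. -/
theorem exists_shift_card_filter_lt {ι X F : Type*} [Fintype ι] [Fintype X] [DecidableEq X]
    [Fintype F] [DecidableEq F] [AddCommGroup F] (φ : ι → X → F) (D : Finset F) (q : ℕ)
    (hqX : q ≤ Fintype.card X)
    (h : Fintype.card ι * (Fintype.card X).choose q * D.card ^ q < Fintype.card F ^ q) :
    ∃ s : X → F, ∀ a, (univ.filter fun x => φ a x - s x ∈ D).card < q := by
  classical
  by_contra! hs
  let E : ι × Finset X → Finset (X → F) := fun w =>
    Fintype.piFinset fun x => if x ∈ w.2 then D.image (fun d => φ w.1 x - d) else univ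
  have hcover : (univ : Finset (X → F)) ⊆
      ((univ : Finset ι) ×ˢ powersetCard q (univ : Finset X)).biUnion E := by
    intro s _
    obtain ⟨a, ha⟩ := hs s
    obtain ⟨T, hT, hTq⟩ := exists_subset_card_eq ha
    refine mem_biUnion.2 ⟨(a, T), by simp [hTq], ?_⟩
    refine Fintype.mem_piFinset.2 fun x => ?_
    by_cases hx : x ∈ T
    · simp only [hx, if_true, mem_image]
      exact ⟨φ a x - s x, (mem_filter.1 (hT hx)).2, by abel⟩
    · simp [hx]
  have hE : ∀ w ∈ (univ : Finset ι) ×ˢ powersetCard q (univ : Finset X),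
      (E w).card ≤ D.card ^ q * Fintype.card F ^ (Fintype.card X - q) := by
    rintro ⟨a, T⟩ hw
    have hT : T.card = q := by simpa using hw
    rw [Fintype.card_piFinset, ← Finset.prod_mul_prod_compl T]
    refine Nat.mul_le_mul ?_ ?_
    · rw [← hT, ← prod_const]
      refine prod_le_prod' fun x hx => ?_
      simpa [hx] using card_image_le
    · rw [← hT, ← card_compl, ← prod_const]
      refine prod_le_prod' fun x hx => ?_
      exact card_le_univ _
  have h1 := (card_le_card hcover).trans (card_biUnion_le_card_mul _ _ _ hE)
  rw [card_univ, Fintype.card_fun, card_product, card_univ, card_powersetCard, card_univ,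
    ← mul_assoc] at h1
  have hF : 0 < Fintype.card F := Fintype.card_pos
  have h2 := Nat.mul_lt_mul_of_pos_right h (pow_pos hF (Fintype.card X - q))
  rw [← pow_add, Nat.add_sub_cancel' hqX] at h2
  exact absurd h1 (not_le.2 h2)

open Finset in
/-- Sets of size at most `q` with pairwise intersections of size at most `ℓ < q` can be
enlarged by private new vertices to the cliques of a system. -/
theorem exists_isSystem_of_card_le {ι V : Type*} [Fintype ι] [Fintype V] [DecidableEq V]
    (B : ι → Finset V) {ℓ q : ℕ} (k : ℕ) (hℓ : ℓ < q) (hB : ∀ i, (B i).card ≤ q)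
    (hBB : ∀ i j, i ≠ j → (B i ∩ B j).card ≤ ℓ) :
    ∃ (N : ℕ) (𝒜 : Finset (Finset (Fin N))), IsSystem ℓ q 𝒜 ∧ 𝒜.card = Fintype.card ι ∧
      ∀ n : ℕ, SysColorable k n 𝒜 → ∃ χ : V → Fin n,
        ∀ i, ∀ S ⊆ B i, S.card = k → ∃ u ∈ S, ∃ w ∈ S, χ u ≠ χ w := by
  classical
  let W := V ⊕ (ι × Fin q)
  let ε : W ≃ Fin (Fintype.card W) := Fintype.equivFin W
  let P : ι → Finset (ι × Fin q) := fun i =>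
    (univ.filter fun t : Fin q => t.val < q - (B i).card).map ⟨Prod.mk i, Prod.mk_right_injective i⟩
  let A : ι → Finset W := fun i => (B i).disjSum (P i)
  have hP : ∀ i, (P i).card = q - (B i).card := by
    intro i
    rw [card_map, Fin.card_filter_val_lt]
    omega
  have hA : ∀ i, (A i).card = q := by
    intro i
    rw [card_disjSum, hP]
    have := hB i
    omega
  have hAA : ∀ i j, i ≠ j → (A i ∩ A j).card ≤ ℓ := by
    intro i j hij
    have hsub : A i ∩ A j ⊆ (B i ∩ B j).map Function.Embedding.inl := by
      intro w hw
      rcases w with v | ⟨l, t⟩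
      · have hw' := mem_inter.1 hw
        exact mem_map_of_mem _ (mem_inter.2 ⟨inl_mem_disjSum.1 hw'.1, inl_mem_disjSum.1 hw'.2⟩)
      · have hw' := mem_inter.1 hw
        have hl : ∀ i', Sum.inr (l, t) ∈ A i' → i' = l := by
          intro i' h'
          obtain ⟨_, _, h''⟩ := mem_map.1 (inr_mem_disjSum.1 h')
          exact (Prod.ext_iff.1 h'').1
        exact absurd ((hl i hw'.1).trans (hl j hw'.2).symm) hij
    simpa using (card_le_card hsub).trans (by simpa using hBB i j hij)
  have hinj : Function.Injective fun i => (A i).map ε.toEmbedding := by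
    intro i j hij
    by_contra hne
    have h1 : A i = A j := map_injective _ hij
    have h2 := hAA i j hne
    rw [← h1, inter_self, hA] at h2
    omega
  refine ⟨_, univ.image fun i => (A i).map ε.toEmbedding, ⟨?_, ?_⟩, ?_, ?_⟩
  · simp [hA]
  · simp only [mem_image, mem_univ, true_and, forall_exists_index, forall_apply_eq_imp_iff]
    intro i j hij
    rw [← map_inter, card_map]
    exact hAA i j fun h => hij (by rw [h])
  · rw [card_image_of_injective _ hinj, card_univ]
  · rintro n ⟨χ, hχ⟩
    refine ⟨fun v => χ (ε (Sum.inl v)), fun i S hS hk => ?_⟩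
    obtain ⟨u, hu, w, hw, huw⟩ := hχ ((A i).map ε.toEmbedding) (mem_image_of_mem _ (mem_univ i))
      (S.map (Function.Embedding.inl.trans ε.toEmbedding)) (by
        rw [← map_map]
        refine map_subset_map.2 fun w hw => ?_
        obtain ⟨v, hv, rfl⟩ := mem_map.1 hw
        exact inl_mem_disjSum.2 (hS hv)) (by rw [card_map, hk])
    obtain ⟨u', hu', rfl⟩ := mem_map.1 hu
    obtain ⟨w', hw', rfl⟩ := mem_map.1 hw
    exact ⟨u', hu', w', hw', huw⟩

open Finset Polynomial in
/-- Blocks on `F × Fin m`: the columns, and the graphs of the polynomials of degree less than `k`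
sheared by a function `s`.  The shear keeps all graphs small, while an independent set meets at
most `k - 1` columns in at most `k - 1` points each. -/
theorem exists_blocks (k p q m : ℕ) [Fact p.Prime] (hk : 2 ≤ k) (hmq : m ≤ q) (hqp : q ≤ p)
    (h : p ^ k * p.choose q * m ^ q < p ^ q) :
    ∃ B : (Fin k → ZMod p) ⊕ ZMod p → Finset (ZMod p × Fin m),
      (∀ i, (B i).card ≤ q) ∧ (∀ i j, i ≠ j → (B i ∩ B j).card ≤ k - 1) ∧
      ∀ C : Finset (ZMod p × Fin m), (∀ i, ∀ S ⊆ B i, S.card = k → ¬ S ⊆ C) →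
        C.card ≤ (k - 1) * (k - 1) := by
  classical
  let f : (Fin k → ZMod p) → (ZMod p)[X] := fun a => ((degreeLTEquiv (ZMod p) k).symm a).1
  have hfdeg : ∀ a, (f a).degree < k := fun a =>
    mem_degreeLT.1 ((degreeLTEquiv (ZMod p) k).symm a).2
  have hfinj : Function.Injective f := fun a b hab =>
    (degreeLTEquiv (ZMod p) k).symm.injective (Subtype.ext hab)
  have hfsurj : ∀ g : (ZMod p)[X], g.degree < k → ∃ a, f a = g := fun g hg =>
    ⟨degreeLTEquiv (ZMod p) k ⟨g, mem_degreeLT.2 hg⟩, by simp [f]⟩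
  let c : Fin m → ZMod p := fun i => (i.val : ZMod p)
  have hc : Function.Injective c := by
    intro i j hij
    have := (ZMod.natCast_eq_natCast_iff' _ _ _).1 hij
    rw [Nat.mod_eq_of_lt (by omega), Nat.mod_eq_of_lt (by omega)] at this
    exact Fin.ext this
  have hD : (univ.image c).card = m := by simp [card_image_of_injective _ hc]
  obtain ⟨s, hs⟩ := exists_shift_card_filter_lt (fun a x => (f a).eval x) (univ.image c) q
    (by simpa [ZMod.card] using hqp) (by simpa [ZMod.card, hD] using h)
  let G : (Fin k → ZMod p) → Finset (ZMod p × Fin m) := fun a =>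
    univ.filter fun v => (f a).eval v.1 = s v.1 + c v.2
  have hGinj : ∀ a, Set.InjOn Prod.fst (G a : Set (ZMod p × Fin m)) := by
    rintro a ⟨x, i⟩ hi ⟨y, j⟩ hj (rfl : x = y)
    have hi' := (mem_filter.1 (mem_coe.1 hi)).2
    have hj' := (mem_filter.1 (mem_coe.1 hj)).2
    exact Prod.ext rfl (hc (add_left_cancel (hi'.symm.trans hj')))
  let K : ZMod p → Finset (ZMod p × Fin m) := fun x => {x} ×ˢ univ
  have hGK : ∀ a x, (G a ∩ K x).card ≤ k - 1 := by
    intro a x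
    refine le_trans (card_le_one.2 fun u hu v hv => ?_) (by omega : 1 ≤ k - 1)
    rw [mem_inter] at hu hv
    have hu' : u.1 = x := mem_singleton.1 (mem_product.1 hu.2).1
    have hv' : v.1 = x := mem_singleton.1 (mem_product.1 hv.2).1
    exact hGinj a (mem_coe.2 hu.1) (mem_coe.2 hv.1) (hu'.trans hv'.symm)
  refine ⟨Sum.elim G K, ?_, ?_, ?_⟩
  · rintro (a | x)
    · refine le_trans ?_ (hs a).le
      rw [Sum.elim_inl, ← card_image_of_injOn (hGinj a)]
      refine card_le_card fun x hx => ?_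
      obtain ⟨v, hv, rfl⟩ := mem_image.1 hx
      have hv' := (mem_filter.1 hv).2
      simp [hv']
    · simpa [K] using hmq
  · rintro (a | x) (b | y) hij
    · simp only [Sum.elim_inl]
      by_contra! hlt
      have hab : a ≠ b := fun h => hij (by rw [h])
      refine hab (hfinj (eq_of_degrees_lt_of_eval_finset_eq ((G a ∩ G b).image Prod.fst)
        ?_ ?_ ?_))
      · rw [card_image_of_injOn ((hGinj a).mono (by simp))]
        exact (hfdeg a).trans_le (by exact_mod_cast (by omega))
      · rw [card_image_of_injOn ((hGinj a).mono (by simp))]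
        exact (hfdeg b).trans_le (by exact_mod_cast (by omega))
      · intro x hx
        obtain ⟨v, hv, rfl⟩ := mem_image.1 hx
        rw [mem_inter] at hv
        exact (mem_filter.1 hv.1).2.trans (mem_filter.1 hv.2).2.symm
    · exact hGK a y
    · rw [inter_comm]
      exact hGK b x
    · have hxy : x ≠ y := fun h => hij (by rw [h])
      have : K x ∩ K y = ∅ := by
        ext v
        simp only [K, mem_inter, mem_product, mem_singleton, mem_univ, and_true, notMem_empty,
          iff_false, not_and]
        rintro rfl h
        exact hxy h
      simp [this]
  · intro C hC
    have hcols : (C.image Prod.fst).card ≤ k - 1 := by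
      by_contra! hlt
      obtain ⟨T, hT, hTk⟩ := exists_subset_card_eq (show k ≤ (C.image Prod.fst).card by omega)
      have hsec : ∀ x : T, ∃ i : Fin m, (x.1, i) ∈ C := by
        rintro ⟨x, hx⟩
        obtain ⟨⟨y, i⟩, hv, rfl⟩ := mem_image.1 (hT hx)
        exact ⟨i, hv⟩
      choose σ hσ using hsec
      let r : ZMod p → ZMod p := fun x => if hx : x ∈ T then s x + c (σ ⟨x, hx⟩) else 0
      obtain ⟨a, ha⟩ := hfsurj (Lagrange.interpolate T id r) (by
        simpa [hTk] using Lagrange.degree_interpolate_lt r (Set.injOn_id (T : Set (ZMod p))))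
      refine hC (Sum.inl a) (T.attach.map ⟨fun x => (x.1, σ x), fun x y hxy =>
        Subtype.ext (Prod.ext_iff.1 hxy).1⟩) ?_ (by simp [hTk]) ?_
      · intro v hv
        obtain ⟨x, -, rfl⟩ := mem_map.1 hv
        have := Lagrange.eval_interpolate_at_node r (Set.injOn_id (T : Set (ZMod p))) x.2
        refine mem_filter.2 ⟨mem_univ _, ?_⟩
        rw [ha]
        exact this.trans (dif_pos x.2)
      · intro v hv
        obtain ⟨x, -, rfl⟩ := mem_map.1 hv
        exact hσ x
    have hfib : ∀ x ∈ C.image Prod.fst, (C.filter fun v => v.1 = x).card ≤ k - 1 := by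
      intro x _
      by_contra! hlt
      obtain ⟨S, hS, hSk⟩ := exists_subset_card_eq
        (show k ≤ (C.filter fun v => v.1 = x).card by omega)
      refine hC (Sum.inr x) S (fun v hv => ?_) hSk (hS.trans (filter_subset _ _))
      exact mem_product.2 ⟨mem_singleton.2 (mem_filter.1 (hS hv)).2, mem_univ _⟩
    exact (card_le_mul_card_image C _ hfib).trans (Nat.mul_le_mul_left _ hcols)

/-- The union bound for the shear, with `m = q / 6`. -/
theorem pow_mul_choose_mul_pow_lt {k p q : ℕ} (hp : 0 < p) (h : p ^ k < 2 ^ q) :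
    p ^ k * p.choose q * (q / 6) ^ q < p ^ q := by
  have hfac : ((q : ℝ) / 3) ^ q ≤ q.factorial := by
    have h1 := Real.pow_div_factorial_le_exp (q : ℝ) (Nat.cast_nonneg q) q
    have h2 : Real.exp (q : ℝ) ≤ 3 ^ q := by
      rw [← Real.exp_one_pow]
      exact pow_le_pow_left₀ (Real.exp_pos 1).le Real.exp_one_lt_three.le q
    rw [div_le_iff₀ (by positivity)] at h1
    rw [div_pow, div_le_iff₀ (by positivity), mul_comm]
    exact h1.trans (mul_le_mul_of_nonneg_right h2 (by positivity))
  have hm : ((2 * (q / 6) : ℕ) : ℝ) ≤ (q : ℝ) / 3 := by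
    have : 6 * (q / 6) ≤ q := Nat.mul_div_le q 6
    have : (6 : ℝ) * (q / 6 : ℕ) ≤ q := by exact_mod_cast this
    push_cast
    linarith
  have hfac' : (2 * (q / 6)) ^ q ≤ q.factorial := by
    have := (pow_le_pow_left₀ (Nat.cast_nonneg _) hm q).trans hfac
    exact_mod_cast this
  have hch : q.factorial * p.choose q ≤ p ^ q := by
    rw [← Nat.descFactorial_eq_factorial_mul_choose]
    exact Nat.descFactorial_le_pow p q
  rcases Nat.eq_zero_or_pos (p.choose q * (q / 6) ^ q) with h0 | h0
  · rw [mul_assoc, h0, mul_zero]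
    exact pow_pos hp q
  · calc p ^ k * p.choose q * (q / 6) ^ q = p ^ k * (p.choose q * (q / 6) ^ q) := mul_assoc _ _ _
      _ < 2 ^ q * (p.choose q * (q / 6) ^ q) := Nat.mul_lt_mul_of_pos_right h h0
      _ = (2 * (q / 6)) ^ q * p.choose q := by rw [mul_pow]; ring
      _ ≤ q.factorial * p.choose q := Nat.mul_le_mul_right _ hfac'
      _ ≤ p ^ q := hch

/-- A prime `p` comparable with `e ^ (1 / k)` such that `p ^ k + p ≤ e`. -/
theorem exists_prime_pow_add_le {k q e : ℕ} (hk : 2 ≤ k) (hq : 1 ≤ q) (he : (50 * q) ^ k < e) :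
    ∃ p : ℕ, p.Prime ∧ q ≤ p ∧ p ^ k + p ≤ e ∧ (e : ℝ) ^ ((1 : ℝ) / k) ≤ 8 * p := by
  set x : ℝ := (e : ℝ) ^ ((1 : ℝ) / k) with hx
  have hxpow : x ^ k = e := by
    rw [hx, one_div]
    exact Real.rpow_inv_natCast_pow (Nat.cast_nonneg e) (by omega)
  have hx0 : 0 ≤ x := by positivity
  have hqx : (50 * q : ℝ) < x := by
    refine lt_of_pow_lt_pow_left₀ k hx0 ?_
    rw [hxpow]
    exact_mod_cast he
  have hq' : (1 : ℝ) ≤ q := by exact_mod_cast hq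
  set n := ⌊x / 4⌋₊ with hn
  have hn1 : (n : ℝ) ≤ x / 4 := Nat.floor_le (by positivity)
  have hn2 : x / 4 < n + 1 := Nat.lt_floor_add_one _
  have hqn : q < n := by
    have : (q : ℝ) < n := by linarith
    exact_mod_cast this
  obtain ⟨p, hp, hnp, hp2⟩ := Nat.exists_prime_lt_and_le_two_mul n (by omega)
  have hnp' : (n : ℝ) < p := by exact_mod_cast hnp
  refine ⟨p, hp, by omega, ?_, by linarith⟩
  have h1 : p ≤ p ^ k := Nat.le_self_pow (by omega) p
  have h2 : 2 * p ^ k ≤ (2 * p) ^ k := by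
    rw [mul_pow]
    exact Nat.mul_le_mul_right _ (Nat.le_self_pow (by omega) 2)
  have h3 : (2 * p) ^ k ≤ e := by
    have hp2' : (p : ℝ) ≤ 2 * n := by exact_mod_cast hp2
    have : (2 * p : ℝ) ^ k ≤ x ^ k := pow_le_pow_left₀ (by positivity) (by linarith) k
    rw [hxpow] at this
    exact_mod_cast this
  omega

/-- For every `k ≥ 2` there are `c > 0` and `q₀` such that for all `q ≥ q₀` and all `e` with
`(50q)^k < e < 2^q` there is a `(q,k)`-system with exactly `e` `q`-cliques whose chromatic
number is at least `c · e^(1/k) · q`. -/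
theorem stmt0 (k : ℕ) (hk : 2 ≤ k) :
    ∃ c : ℝ, 0 < c ∧ ∃ q₀ : ℕ, ∀ q : ℕ, q₀ ≤ q → ∀ e : ℕ,
      (50 * q) ^ k < e → e < 2 ^ q →
      ∃ (N : ℕ) (𝒜 : Finset (Finset (Fin N))),
        IsSystem (k - 1) q 𝒜 ∧ 𝒜.card = e ∧
        ∀ n : ℕ, SysColorable k n 𝒜 →
          c * (e : ℝ) ^ ((1 : ℝ) / k) * q ≤ n := by
  refine ⟨1 / (96 * k ^ 2), by positivity, k + 6, fun q hq e he1 he2 => ?_⟩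
  obtain ⟨p, hp, hqp, hpe, hep⟩ := exists_prime_pow_add_le hk (by omega) he1
  have : Fact p.Prime := ⟨hp⟩
  obtain ⟨B, hB, hBB, hind⟩ := exists_blocks k p q (q / 6) hk (Nat.div_le_self q 6) hqp
    (pow_mul_choose_mul_pow_lt hp.pos (by omega))
  obtain ⟨N, 𝒜, hsys, hcard, hcol⟩ := exists_isSystem_of_card_le (ℓ := k - 1) (q := q)
    (Sum.elim B (fun _ : Fin (e - (p ^ k + p)) => ∅)) k (by omega)
    (by rintro (i | i) <;> simp [hB])
    (by
      rintro (i | i) (j | j) hij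
      · exact hBB i j fun h => hij (by rw [h])
      all_goals simp)
  refine ⟨N, 𝒜, hsys, ?_, fun n hn => ?_⟩
  · rw [hcard]
    simp [ZMod.card]
    omega
  obtain ⟨χ, hχ⟩ := hcol n hn
  have hclass : ∀ b ∈ (Finset.univ : Finset (Fin n)),
      (Finset.univ.filter fun v => χ v = b).card ≤ (k - 1) * (k - 1) := by
    intro b _
    refine hind _ fun i S hS hSk hSC => ?_
    obtain ⟨u, hu, w, hw, huw⟩ := hχ (Sum.inl i) S hS hSk
    exact huw ((Finset.mem_filter.1 (hSC hu)).2.trans (Finset.mem_filter.1 (hSC hw)).2.symm)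
  have htotal : p * (q / 6) ≤ (k - 1) * (k - 1) * n := by
    have := Finset.card_le_mul_card_image_of_maps_to
      (s := (Finset.univ : Finset (ZMod p × Fin (q / 6)))) (f := χ)
      (fun _ _ => Finset.mem_univ _) _ hclass
    simpa [ZMod.card] using this
  have htotal' : p * (q / 6) ≤ k ^ 2 * n :=
    htotal.trans (Nat.mul_le_mul_right _ (by
      rw [sq]; exact Nat.mul_le_mul (Nat.sub_le k 1) (Nat.sub_le k 1)))
  have hm : q ≤ 12 * (q / 6) := by omega
  have hm' : (q : ℝ) ≤ 12 * (q / 6 : ℕ) := by exact_mod_cast hm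
  have ht : (p : ℝ) * (q / 6 : ℕ) ≤ k ^ 2 * n := by exact_mod_cast htotal'
  have hmain : (e : ℝ) ^ ((1 : ℝ) / k) * q ≤ 96 * k ^ 2 * n :=
    calc (e : ℝ) ^ ((1 : ℝ) / k) * q ≤ (8 * p) * (12 * (q / 6 : ℕ)) := by gcongr
      _ = 96 * (p * (q / 6 : ℕ)) := by ring
      _ ≤ 96 * (k ^ 2 * n) := by gcongr
      _ = 96 * k ^ 2 * n := by ring
  rw [mul_assoc, one_div, inv_mul_le_iff₀ (by positivity)]
  exact hmain
end

section
/- For every integer k ≥ 2 there is a constant C > 0 such that every k-uniform hypergraph with m ≥ 1 edges has chromatic number at most C · m^{1/k}. -/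
/-- The colourings of `V` that vanish off `S` and are not constant on any edge inside `S`. -/
noncomputable def properOn {V : Type} [Fintype V] (n : ℕ) [NeZero n] (E : Finset (Finset V))
    (S : Finset V) : Finset (V → Fin n) := by
  classical
  exact Finset.univ.filter fun f => (∀ v, v ∉ S → f v = 0) ∧
    ∀ e ∈ E, e ⊆ S → ∃ u ∈ e, ∃ w ∈ e, f u ≠ f w

theorem mem_properOn {V : Type} [Fintype V] {n : ℕ} [NeZero n] {E : Finset (Finset V)}
    {S : Finset V} {f : V → Fin n} :
    f ∈ properOn n E S ↔ (∀ v, v ∉ S → f v = 0) ∧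
      ∀ e ∈ E, e ⊆ S → ∃ u ∈ e, ∃ w ∈ e, f u ≠ f w := by
  simp [properOn]

open Classical in
/-- Extensions of proper colourings of `S` to `v` that are constant on `e` are determined by
their restriction to the complement of all but one vertex of `e`. -/
theorem card_monochromatic_le {V : Type} [Fintype V] {n : ℕ} [NeZero n]
    {E : Finset (Finset V)} {S e : Finset V} {u v : V} (hv : v ∈ e) (huv : u ≠ v)
    (B : Finset (V → Fin n))
    (hB : ∀ g ∈ B, (∃ f ∈ properOn n E S, ∃ c, g = Function.update f v c) ∧
      ∀ x ∈ e, g x = g u) :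
    B.card ≤ (properOn n E (S \ e.erase u)).card := by
  refine Finset.card_le_card_of_injOn (fun g x => if x ∈ e.erase u then 0 else g x) ?_ ?_
  · intro g hg
    obtain ⟨⟨f, hf, c, rfl⟩, -⟩ := hB g hg
    rw [mem_properOn] at hf
    rw [Finset.mem_coe, mem_properOn]
    have key : ∀ x, x ∉ e.erase u → Function.update f v c x = f x := by
      intro x hx
      refine Function.update_of_ne ?_ _ _
      rintro rfl
      exact hx (Finset.mem_erase.2 ⟨huv.symm, hv⟩)
    refine ⟨fun x hx => ?_, fun d hd hdS => ?_⟩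
    · by_cases hxe : x ∈ e.erase u
      · simp only [if_pos hxe]
      · simp only [if_neg hxe, key x hxe]
        exact hf.1 x fun hxS => hx (Finset.mem_sdiff.2 ⟨hxS, hxe⟩)
    · obtain ⟨a, ha, b, hb, hab⟩ := hf.2 d hd (hdS.trans Finset.sdiff_subset)
      have ha' := (Finset.mem_sdiff.1 (hdS ha)).2
      have hb' := (Finset.mem_sdiff.1 (hdS hb)).2
      refine ⟨a, ha, b, hb, ?_⟩
      simpa only [if_neg ha', if_neg hb', key a ha', key b hb'] using hab
  · intro g hg g' hg' h
    have hout : ∀ x, x ∉ e.erase u → g x = g' x := fun x hx => by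
      simpa only [if_neg hx] using congrFun h x
    funext x
    by_cases hx : x ∈ e.erase u
    · have hxe := Finset.mem_of_mem_erase hx
      rw [(hB g hg).2 x hxe, (hB g' hg').2 x hxe]
      exact hout u (Finset.notMem_erase u e)
    · exact hout x hx

open Classical in
theorem mul_card_properOn_le_insert {V : Type} [Fintype V] {k t : ℕ} (hk : 2 ≤ k) (ht : 1 ≤ t)
    [NeZero (2 * t)] {E : Finset (Finset V)} (hE : ∀ e ∈ E, e.card = k)
    (hdeg : ∀ v, (E.filter (v ∈ ·)).card ≤ t ^ (k - 1)) {S : Finset V} {v : V} (hv : v ∉ S)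
    (hmono : ∀ T ⊆ S, t ^ (S \ T).card * (properOn (2 * t) E T).card
      ≤ (properOn (2 * t) E S).card) :
    t * (properOn (2 * t) E S).card ≤ (properOn (2 * t) E (insert v S)).card := by
  set A := properOn (2 * t) E S with hA
  set B := (A ×ˢ (Finset.univ : Finset (Fin (2 * t)))).image
    (fun p => Function.update p.1 v p.2) with hBdef
  have hBcard : B.card = 2 * t * A.card := by
    rw [hBdef, Finset.card_image_of_injOn, Finset.card_product, Finset.card_univ,
      Fintype.card_fin, mul_comm]
    rintro ⟨f, c⟩ hf ⟨f', c'⟩ hf' h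
    have hf0 := (mem_properOn.1 (Finset.mem_product.1 hf).1).1 v hv
    have hf0' := (mem_properOn.1 (Finset.mem_product.1 hf').1).1 v hv
    have hc : c = c' := by simpa using congrFun h v
    refine Prod.ext (funext fun x => ?_) hc
    by_cases hx : x = v
    · subst hx
      exact hf0.trans hf0'.symm
    · simpa [hx] using congrFun h x
  have hBmem : ∀ g ∈ B, ∃ f ∈ A, ∃ c, g = Function.update f v c := by
    intro g hg
    obtain ⟨⟨f, c⟩, hp, rfl⟩ := Finset.mem_image.1 hg
    exact ⟨f, (Finset.mem_product.1 hp).1, c, rfl⟩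
  set D := E.filter fun e => v ∈ e ∧ e ⊆ insert v S with hD
  set M : Finset V → Finset (V → Fin (2 * t)) :=
    fun e => B.filter fun g => ∀ x ∈ e, ∀ y ∈ e, g x = g y with hM
  have hcover : B ⊆ properOn (2 * t) E (insert v S) ∪ D.biUnion M := by
    intro g hg
    by_cases hgood : g ∈ D.biUnion M
    · exact Finset.mem_union_right _ hgood
    refine Finset.mem_union_left _ (mem_properOn.2 ⟨fun x hx => ?_, fun e he heS => ?_⟩)
    · obtain ⟨f, hf, c, rfl⟩ := hBmem g hg
      rw [Finset.mem_insert, not_or] at hx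
      rw [Function.update_of_ne hx.1]
      exact (mem_properOn.1 hf).1 x hx.2
    · by_cases hve : v ∈ e
      · by_contra! hcon
        exact hgood (Finset.mem_biUnion.2 ⟨e, Finset.mem_filter.2 ⟨he, hve, heS⟩,
          Finset.mem_filter.2 ⟨hg, hcon⟩⟩)
      · obtain ⟨f, hf, c, rfl⟩ := hBmem g hg
        obtain ⟨a, ha, b, hb, hab⟩ :=
          (mem_properOn.1 hf).2 e he ((Finset.subset_insert_iff_of_notMem hve).1 heS)
        refine ⟨a, ha, b, hb, ?_⟩
        rwa [Function.update_of_ne (ne_of_mem_of_not_mem ha hve),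
          Function.update_of_ne (ne_of_mem_of_not_mem hb hve)]
  have hMcard : ∀ e ∈ D, t ^ (k - 2) * (M e).card ≤ A.card := by
    intro e he
    obtain ⟨heE, hve, heS⟩ := Finset.mem_filter.1 he
    have hek := hE e heE
    obtain ⟨u, hu, huv⟩ := Finset.exists_mem_ne (by omega : 1 < e.card) v
    have h1 : (M e).card ≤ (properOn (2 * t) E (S \ e.erase u)).card :=
      card_monochromatic_le hve huv (M e) fun g hg => by
        obtain ⟨hgB, hgm⟩ := Finset.mem_filter.1 hg
        exact ⟨hBmem g hgB, fun x hx => hgm x hx u hu⟩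
    have h2 := hmono (S \ e.erase u) Finset.sdiff_subset
    have h3 : S \ (S \ e.erase u) = (e.erase u).erase v := by
      ext x
      have hxS : x ∈ e → x = v ∨ x ∈ S := fun h => Finset.mem_insert.1 (heS h)
      have hxv : x = v → x ∉ S := fun h => h ▸ hv
      simp only [Finset.mem_sdiff, Finset.mem_erase]
      tauto
    have h4 : ((e.erase u).erase v).card = k - 2 := by
      rw [Finset.card_erase_of_mem (Finset.mem_erase.2 ⟨huv.symm, hve⟩),
        Finset.card_erase_of_mem hu, hek]
      omega
    rw [h3, h4] at h2
    exact (Nat.mul_le_mul_left _ h1).trans h2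
  have hDcard : D.card ≤ t ^ (k - 1) :=
    (Finset.card_le_card (Finset.monotone_filter_right E fun e _ h => h.1)).trans (hdeg v)
  have hbad : (D.biUnion M).card ≤ t * A.card := by
    refine Nat.le_of_mul_le_mul_left ?_ (pow_pos ht (k - 2))
    calc t ^ (k - 2) * (D.biUnion M).card
        ≤ t ^ (k - 2) * ∑ e ∈ D, (M e).card := Nat.mul_le_mul_left _ Finset.card_biUnion_le
      _ = ∑ e ∈ D, t ^ (k - 2) * (M e).card := Finset.mul_sum _ _ _
      _ ≤ D.card * A.card := by
        simpa using Finset.sum_le_card_nsmul D _ _ hMcard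
      _ ≤ t ^ (k - 1) * A.card := Nat.mul_le_mul_right _ hDcard
      _ = t ^ (k - 2) * (t * A.card) := by
        rw [← mul_assoc, ← pow_succ]
        congr 2
        omega
  have := (Finset.card_le_card hcover).trans (Finset.card_union_le _ _)
  rw [hBcard] at this
  linarith

open Classical in
/-- The number of proper colourings grows by a factor of at least `t` with each vertex. -/
theorem pow_mul_card_properOn_le {V : Type} [Fintype V] {k t : ℕ} (hk : 2 ≤ k) (ht : 1 ≤ t)
    [NeZero (2 * t)] {E : Finset (Finset V)} (hE : ∀ e ∈ E, e.card = k)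
    (hdeg : ∀ v, (E.filter (v ∈ ·)).card ≤ t ^ (k - 1)) (S : Finset V) :
    ∀ T ⊆ S, t ^ (S \ T).card * (properOn (2 * t) E T).card
      ≤ (properOn (2 * t) E S).card := by
  induction S using Finset.strongInduction with
  | H S ih =>
    intro T hTS
    obtain rfl | hlt := hTS.eq_or_ssubset
    · simp
    obtain ⟨v, hvS, hvT⟩ := Finset.exists_of_ssubset hlt
    have hss := Finset.erase_ssubset hvS
    have hstep := mul_card_properOn_le_insert hk ht hE hdeg (Finset.notMem_erase v S) (ih _ hss)
    rw [Finset.insert_erase hvS] at hstep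
    have hT := ih _ hss T (Finset.subset_erase.2 ⟨hTS, hvT⟩)
    have hcard : (S \ T).card = (S.erase v \ T).card + 1 := by
      rw [Finset.erase_sdiff_comm, Finset.card_erase_add_one (Finset.mem_sdiff.2 ⟨hvS, hvT⟩)]
    calc t ^ (S \ T).card * (properOn (2 * t) E T).card
        = t * (t ^ (S.erase v \ T).card * (properOn (2 * t) E T).card) := by
          rw [hcard, pow_succ]; ring
      _ ≤ t * (properOn (2 * t) E (S.erase v)).card := Nat.mul_le_mul_left _ hT
      _ ≤ _ := hstep

open Classical in
/-- A `k`-uniform hypergraph with degrees at most `t ^ (k - 1)` is `2 * t`-colourable. -/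
theorem exists_coloring_of_degree_le {V : Type} [Fintype V] {k t : ℕ} (hk : 2 ≤ k) (ht : 1 ≤ t)
    {E : Finset (Finset V)} (hE : ∀ e ∈ E, e.card = k)
    (hdeg : ∀ v, (E.filter (v ∈ ·)).card ≤ t ^ (k - 1)) :
    ∃ χ : V → Fin (2 * t), ∀ e ∈ E, ∃ u ∈ e, ∃ w ∈ e, χ u ≠ χ w := by
  have : NeZero (2 * t) := ⟨by omega⟩
  have hempty : (0 : V → Fin (2 * t)) ∈ properOn (2 * t) E ∅ := by
    refine mem_properOn.2 ⟨fun _ _ => rfl, fun e he hsub => ?_⟩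
    have := hE e he
    rw [Finset.subset_empty.1 hsub, Finset.card_empty] at this
    omega
  have h := pow_mul_card_properOn_le hk ht hE hdeg Finset.univ ∅ (Finset.empty_subset _)
  have hpos : 0 < (properOn (2 * t) E Finset.univ).card :=
    (Nat.mul_pos (pow_pos ht _) (Finset.card_pos.2 ⟨_, hempty⟩)).trans_le h
  obtain ⟨χ, hχ⟩ := Finset.card_pos.1 hpos
  exact ⟨χ, fun e he => (mem_properOn.1 hχ).2 e he (Finset.subset_univ e)⟩

open Classical in
theorem exists_coloring_of_card_le_pow_of_fintype {V : Type} [Fintype V] {k t : ℕ} (hk : 2 ≤ k)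
    (ht : 1 ≤ t) {E : Finset (Finset V)} (hE : ∀ e ∈ E, e.card = k) (hm : E.card ≤ t ^ k) :
    ∃ χ : V → Fin (2 * t + k * t), ∀ e ∈ E, ∃ u ∈ e, ∃ w ∈ e, χ u ≠ χ w := by
  set H : Finset V := Finset.univ.filter fun v => t ^ (k - 1) < (E.filter (v ∈ ·)).card with hH
  have hHcard : H.card ≤ k * t := by
    refine Nat.le_of_mul_le_mul_left ?_ (pow_pos ht (k - 1))
    calc t ^ (k - 1) * H.card = ∑ v ∈ H, t ^ (k - 1) := by simp [mul_comm]
      _ ≤ ∑ v ∈ H, (E.filter (v ∈ ·)).card :=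
        Finset.sum_le_sum fun v hv => (Finset.mem_filter.1 hv).2.le
      _ ≤ ∑ v, (E.filter (v ∈ ·)).card :=
        Finset.sum_le_sum_of_subset (Finset.subset_univ _)
      _ = ∑ e ∈ E, e.card := by
        have := Finset.sum_card_bipartiteAbove_eq_sum_card_bipartiteBelow
          (s := (Finset.univ : Finset V)) (t := E) (fun v e => v ∈ e)
        simpa [Finset.bipartiteAbove, Finset.bipartiteBelow] using this
      _ = E.card * k := by rw [Finset.sum_congr rfl hE]; simp
      _ ≤ t ^ k * k := Nat.mul_le_mul_right _ hm
      _ = t ^ (k - 1) * (k * t) := by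
        obtain ⟨j, rfl⟩ : ∃ j, k = j + 1 := ⟨k - 1, by omega⟩
        rw [Nat.add_sub_cancel, pow_succ]
        ring
  obtain ⟨χ, hχ⟩ := exists_coloring_of_degree_le (E := E.filter (Disjoint · H)) hk ht
    (fun e he => hE e (Finset.mem_filter.1 he).1) (by
      intro v
      by_cases hv : v ∈ H
      · rw [Finset.card_eq_zero.2 (Finset.filter_eq_empty_iff.2 fun e he hve =>
          Finset.disjoint_left.1 (Finset.mem_filter.1 he).2 hve hv)]
        exact Nat.zero_le _
      · refine (Finset.card_le_card
          (Finset.filter_subset_filter _ (Finset.filter_subset _ _))).trans ?_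
        simpa [hH] using hv)
  obtain ⟨φ⟩ : Nonempty (H ↪ Fin (k * t)) :=
    Function.Embedding.nonempty_of_card_le (by simpa using hHcard)
  let ψ : V → Fin (2 * t) ⊕ Fin (k * t) :=
    fun v => if h : v ∈ H then Sum.inr (φ ⟨v, h⟩) else Sum.inl (χ v)
  have hψ : ∀ e ∈ E, ∃ u ∈ e, ∃ w ∈ e, ψ u ≠ ψ w := by
    intro e he
    by_cases hd : Disjoint e H
    · obtain ⟨u, hu, w, hw, huw⟩ := hχ e (Finset.mem_filter.2 ⟨he, hd⟩)
      refine ⟨u, hu, w, hw, ?_⟩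
      simpa [ψ, Finset.disjoint_left.1 hd hu, Finset.disjoint_left.1 hd hw] using huw
    · obtain ⟨v, hve, hvH⟩ := Finset.not_disjoint_iff.1 hd
      obtain ⟨u, hu, huv⟩ := Finset.exists_mem_ne (by have := hE e he; omega : 1 < e.card) v
      refine ⟨u, hu, v, hve, ?_⟩
      by_cases huH : u ∈ H
      · simpa [ψ, huH, hvH] using huv
      · simp [ψ, huH, hvH]
  refine ⟨fun v => finSumFinEquiv (ψ v), fun e he => ?_⟩
  obtain ⟨u, hu, w, hw, huw⟩ := hψ e he
  exact ⟨u, hu, w, hw, fun h => huw (finSumFinEquiv.injective h)⟩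

open Classical in
/-- A `k`-uniform hypergraph with at most `t ^ k` edges is `(2 + k) * t`-colourable. -/
theorem exists_coloring_of_card_le_pow {V : Type} {k t : ℕ} (hk : 2 ≤ k)
    (ht : 1 ≤ t) {E : Finset (Finset V)} (hE : ∀ e ∈ E, e.card = k) (hm : E.card ≤ t ^ k) :
    ∃ χ : V → Fin (2 * t + k * t), ∀ e ∈ E, ∃ u ∈ e, ∃ w ∈ e, χ u ≠ χ w := by
  have : NeZero (2 * t + k * t) := ⟨by omega⟩
  set U : Finset V := E.biUnion id with hU
  have hsub : ∀ e ∈ E, ∀ x ∈ e, x ∈ U := fun e he x hx => Finset.mem_biUnion.2 ⟨e, he, hx⟩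
  obtain ⟨χ, hχ⟩ := exists_coloring_of_card_le_pow_of_fintype (V := {x // x ∈ U})
    (E := E.image (Finset.subtype (· ∈ U))) hk ht (by
      intro e' he'
      obtain ⟨e, he, rfl⟩ := Finset.mem_image.1 he'
      rw [Finset.card_subtype, Finset.filter_true_of_mem (hsub e he), hE e he])
    (Finset.card_image_le.trans hm)
  refine ⟨fun x => if h : x ∈ U then χ ⟨x, h⟩ else 0, fun e he => ?_⟩
  obtain ⟨u, hu, w, hw, huw⟩ := hχ _ (Finset.mem_image_of_mem _ he)
  refine ⟨u, Finset.mem_subtype.1 hu, w, Finset.mem_subtype.1 hw, ?_⟩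
  simpa [u.2, w.2] using huw

/-- For every `k ≥ 2` there is `C > 0` such that every `k`-uniform hypergraph with `m ≥ 1`
edges has chromatic number at most `C · m^(1/k)`. -/
theorem stmt1 (k : ℕ) (hk : 2 ≤ k) :
    ∃ C : ℝ, 0 < C ∧
      ∀ (V : Type) (E : Finset (Finset V)),
        (∀ S ∈ E, S.card = k) → 1 ≤ E.card →
        ∃ n : ℕ, (n : ℝ) ≤ C * (E.card : ℝ) ^ ((1 : ℝ) / k) ∧
          ∃ χ : V → Fin n, ∀ S ∈ E, ∃ u ∈ S, ∃ w ∈ S, χ u ≠ χ w := by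
  refine ⟨(2 + k) * 2, by positivity, fun V E hE hm => ?_⟩
  set r : ℝ := (E.card : ℝ) ^ ((1 : ℝ) / k) with hr
  have hr1 : 1 ≤ r := Real.one_le_rpow (by exact_mod_cast hm) (by positivity)
  have hrk : r ^ k = E.card := by
    rw [hr, one_div]
    exact Real.rpow_inv_natCast_pow (Nat.cast_nonneg _) (by omega)
  have hle : r ≤ ⌈r⌉₊ := Nat.le_ceil r
  have hlt : (⌈r⌉₊ : ℝ) < r + 1 := Nat.ceil_lt_add_one (by linarith)
  have hcard : E.card ≤ ⌈r⌉₊ ^ k := by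
    have : (E.card : ℝ) ≤ (⌈r⌉₊ : ℝ) ^ k := hrk ▸ pow_le_pow_left₀ (by linarith) hle k
    exact_mod_cast this
  refine ⟨2 * ⌈r⌉₊ + k * ⌈r⌉₊, ?_,
    exists_coloring_of_card_le_pow hk (by exact_mod_cast hr1.trans hle) hE hcard⟩
  push_cast
  rw [← add_mul, mul_assoc]
  exact mul_le_mul_of_nonneg_left (by linarith) (by positivity)
end

section
/- For all integers q and e with 2 < q < e < q², every graph that is the union of e cliques of size q, any two of which share at most one vertex, has chromatic number less than 3e/2. -/
namespace CliqueSystem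

open Finset

variable {V : Type*} [DecidableEq V] {k : ℕ}

/-- The members of `𝒜` that contain the vertex `v`. -/
def star (𝒜 : Finset (Finset V)) (v : V) : Finset (Finset V) := 𝒜.filter (v ∈ ·)

theorem mem_star {𝒜 : Finset (Finset V)} {v : V} {A : Finset V} :
    A ∈ star 𝒜 v ↔ A ∈ 𝒜 ∧ v ∈ A := by simp [star]

/-- `χ` colors the vertices of `S` so that no two of them in a common clique agree. -/
def ProperOn (𝒜 : Finset (Finset V)) (S : Finset V) (χ : V → Fin k) : Prop :=
  ∀ A ∈ 𝒜, ∀ u ∈ A, ∀ w ∈ A, u ∈ S → w ∈ S → χ u = χ w → u = w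

/-- The colors that `χ` does not use on the vertices of `S` in `A`. -/
def missing (S : Finset V) (χ : V → Fin k) (A : Finset V) : Finset (Fin k) :=
  univ \ (A ∩ S).image χ

theorem mem_missing {S : Finset V} {χ : V → Fin k} {A : Finset V} {c : Fin k} :
    c ∈ missing S χ A ↔ ∀ u ∈ A, u ∈ S → χ u ≠ c := by
  simp [missing]

theorem card_missing {𝒜 : Finset (Finset V)} {S : Finset V} {χ : V → Fin k}
    (h : ProperOn 𝒜 S χ) {A : Finset V} (hA : A ∈ 𝒜) :
    (missing S χ A).card + (A ∩ S).card = k := by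
  have hi : ((A ∩ S).image χ).card = (A ∩ S).card := by
    apply card_image_of_injOn
    intro u hu w hw huw
    simp only [coe_inter, Set.mem_inter_iff, mem_coe] at hu hw
    exact h A hA u hu.1 w hw.1 hu.2 hw.2 huw
  have := card_sdiff_add_card_eq_card (subset_univ ((A ∩ S).image χ))
  rw [hi, card_univ, Fintype.card_fin] at this
  exact this

theorem ProperOn.update_insert {𝒜 : Finset (Finset V)} {S : Finset V} {χ : V → Fin k}
    (h : ProperOn 𝒜 S χ) {v : V} (hv : v ∉ S) {c : Fin k}
    (hc : ∀ A ∈ star 𝒜 v, c ∈ missing S χ A) :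
    ProperOn 𝒜 (insert v S) (Function.update χ v c) := by
  intro A hA u hu w hw huS hwS huw
  have hcA := fun hvA => mem_missing.1 (hc A (mem_star.2 ⟨hA, hvA⟩))
  have := h A hA u hu w hw
  rw [mem_insert] at huS hwS
  by_cases h1 : u = v <;> by_cases h2 : w = v
  · rw [h1, h2]
  · subst h1
    simp only [Function.update_self, Function.update_of_ne h2] at huw
    exact absurd huw.symm (hcA hu w hw (hwS.resolve_left h2))
  · subst h2
    simp only [Function.update_self, Function.update_of_ne h1] at huw
    exact absurd huw (hcA hw u hu (huS.resolve_left h1))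
  · simp only [Function.update_of_ne h1, Function.update_of_ne h2] at huw
    exact this (huS.resolve_left h1) (hwS.resolve_left h2) huw

theorem ProperOn.recolor {𝒜 : Finset (Finset V)} {S : Finset V} {χ : V → Fin k}
    (h : ProperOn 𝒜 S χ) {v : V} (hv : v ∈ S) {c : Fin k}
    (hc : ∀ A ∈ star 𝒜 v, c ∈ missing S χ A) :
    ProperOn 𝒜 S (Function.update χ v c) := by
  have h' : ProperOn 𝒜 (S.erase v) χ := fun A hA u hu w hw huS hwS =>
    h A hA u hu w hw (mem_of_mem_erase huS) (mem_of_mem_erase hwS)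
  have := h'.update_insert (notMem_erase v S) (c := c) fun A hA =>
    mem_missing.2 fun u hu huS => mem_missing.1 (hc A hA) u hu (mem_of_mem_erase huS)
  rwa [insert_erase hv] at this

theorem ProperOn.exists_insert {𝒜 : Finset (Finset V)} {S : Finset V} {χ : V → Fin k}
    (h : ProperOn 𝒜 S χ) {v : V} (hv : v ∉ S)
    (hlt : ∑ A ∈ star 𝒜 v, (A ∩ S).card < k) :
    ∃ χ' : V → Fin k, ProperOn 𝒜 (insert v S) χ' := by
  have hcard : (((star 𝒜 v).biUnion (· ∩ S)).image χ).card < (univ : Finset (Fin k)).card := by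
    rw [card_univ, Fintype.card_fin]
    exact (card_image_le.trans card_biUnion_le).trans_lt hlt
  obtain ⟨c, -, hc⟩ := exists_mem_notMem_of_card_lt_card hcard
  refine ⟨_, h.update_insert hv (c := c) fun A hA => mem_missing.2 fun u hu huS huc => hc ?_⟩
  exact mem_image.2 ⟨u, mem_biUnion.2 ⟨A, hA, mem_inter.2 ⟨hu, huS⟩⟩, huc⟩

/-- Any two members of `𝒜` share at most one vertex. -/
def Linear (𝒜 : Finset (Finset V)) : Prop :=
  ∀ A ∈ 𝒜, ∀ B ∈ 𝒜, ∀ u w, u ∈ A → u ∈ B → w ∈ A → w ∈ B → u ≠ w → A = B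

theorem Linear.sum_card_star_le {𝒜 : Finset (Finset V)} (hl : Linear 𝒜) {A : Finset V}
    (hA : A ∈ 𝒜) {T : Finset V} (hT : T ⊆ A) :
    ∑ u ∈ T, ((star 𝒜 u).card - 1) + 1 ≤ 𝒜.card := by
  have hd : (T : Set V).PairwiseDisjoint fun u => (star 𝒜 u).erase A := by
    intro u hu w hw huw
    refine disjoint_left.2 fun B hB hB' => ?_
    rw [mem_erase, mem_star] at hB hB'
    exact hB.1 (hl A hA B hB.2.1 u w (hT hu) hB.2.2 (hT hw) hB'.2.2 huw).symm
  have hsub : T.biUnion (fun u => (star 𝒜 u).erase A) ⊆ 𝒜.erase A := by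
    intro B hB
    obtain ⟨u, -, hB⟩ := mem_biUnion.1 hB
    rw [mem_erase, mem_star] at hB
    exact mem_erase.2 ⟨hB.1, hB.2.1⟩
  have h := card_le_card hsub
  rw [card_biUnion hd, card_erase_of_mem hA] at h
  have he : ∑ u ∈ T, ((star 𝒜 u).erase A).card = ∑ u ∈ T, ((star 𝒜 u).card - 1) :=
    sum_congr rfl fun u hu => card_erase_of_mem (mem_star.2 ⟨hA, hT hu⟩)
  have := card_pos.2 ⟨A, hA⟩
  omega

/-- The vertices of `A ∩ S` lying in at least three cliques. -/
def heavy (𝒜 : Finset (Finset V)) (S A : Finset V) : Finset V :=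
  (A ∩ S).filter fun u => 3 ≤ (star 𝒜 u).card

theorem card_inter_add_card_heavy_le {𝒜 : Finset (Finset V)} {S : Finset V}
    (hS : ∀ u ∈ S, 2 ≤ (star 𝒜 u).card) (A : Finset V) :
    (A ∩ S).card + (heavy 𝒜 S A).card ≤ ∑ u ∈ A ∩ S, ((star 𝒜 u).card - 1) := by
  rw [heavy, card_filter, card_eq_sum_ones, ← sum_add_distrib]
  refine sum_le_sum fun u hu => ?_
  have := hS u (mem_inter.1 hu).2
  split_ifs <;> omega

theorem Linear.exists_insert_of_three_le {𝒜 : Finset (Finset V)} (hl : Linear 𝒜) {S : Finset V}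
    {χ : V → Fin k} (h : ProperOn 𝒜 S χ) {v : V} (hv : v ∉ S)
    (hd : 3 ≤ (star 𝒜 v).card) (hS : ∀ u ∈ S, (star 𝒜 v).card ≤ (star 𝒜 u).card)
    (hk : 3 * 𝒜.card ≤ 2 * k + 2) :
    ∃ χ' : V → Fin k, ProperOn 𝒜 (insert v S) χ' := by
  apply h.exists_insert hv
  obtain ⟨m, hm⟩ : ∃ m, (star 𝒜 v).card = m + 1 := ⟨(star 𝒜 v).card - 1, by omega⟩
  have key : ∀ A ∈ star 𝒜 v, (A ∩ S).card * m + (m + 1) ≤ 𝒜.card := by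
    intro A hA
    rw [mem_star] at hA
    have h1 := hl.sum_card_star_le hA.1 (T := insert v (A ∩ S))
      (insert_subset hA.2 inter_subset_left)
    rw [sum_insert (by simp [hv]), hm] at h1
    have h2 : ∑ u ∈ A ∩ S, m ≤ ∑ u ∈ A ∩ S, ((star 𝒜 u).card - 1) :=
      sum_le_sum fun u hu => by have := hS u (mem_inter.1 hu).2; omega
    rw [sum_const, smul_eq_mul] at h2
    omega
  have hsum := sum_le_sum key
  rw [sum_add_distrib, ← sum_mul, sum_const, sum_const, hm, smul_eq_mul, smul_eq_mul] at hsum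
  by_contra! hcon
  have hcm := Nat.mul_le_mul_right m hcon
  have hm2 : 2 ≤ m := by omega
  zify at *
  nlinarith [mul_nonneg (sub_nonneg.2 hm2) (Nat.cast_nonneg (α := ℤ) 𝒜.card)]

/-- If no color is missing at both `X` and `Y`, then every color missing at `Y` appears on a vertex
of `X`. Apart from the heavy ones, these vertices lie in exactly one further clique each, and those
cliques are distinct. -/
theorem Linear.card_missing_le {𝒜 : Finset (Finset V)} (hl : Linear 𝒜) {S : Finset V}
    {χ : V → Fin k} (hS : ∀ u ∈ S, 2 ≤ (star 𝒜 u).card) {X Y : Finset V} (hX : X ∈ 𝒜)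
    (hXY : Disjoint (missing S χ X) (missing S χ Y)) :
    (missing S χ Y).card ≤ (heavy 𝒜 S X).card +
      (𝒜.filter fun Z => ∃ u ∈ S, χ u ∈ missing S χ Y ∧ X ≠ Z ∧ star 𝒜 u = {X, Z}).card := by
  set P := 𝒜.filter fun Z => ∃ u ∈ S, χ u ∈ missing S χ Y ∧ X ≠ Z ∧ star 𝒜 u = {X, Z}
  set L := ((X ∩ S).filter fun u => ¬ 3 ≤ (star 𝒜 u).card).filter fun u => χ u ∈ missing S χ Y
  have h1 : missing S χ Y ⊆ (heavy 𝒜 S X ∪ L).image χ := by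
    intro c hc
    have hc' := disjoint_right.1 hXY hc
    rw [mem_missing] at hc'
    push Not at hc'
    obtain ⟨u, hu, huS, rfl⟩ := hc'
    refine mem_image_of_mem _ ?_
    simp only [heavy, L, mem_union, mem_filter, mem_inter]
    tauto
  have h2 : L.card ≤ P.card := by
    have hex : ∀ u ∈ L, ∃ Z ∈ P, X ≠ Z ∧ star 𝒜 u = {X, Z} := by
      intro u hu
      simp only [L, mem_filter, mem_inter] at hu
      obtain ⟨⟨⟨huX, huS⟩, hu3⟩, huc⟩ := hu
      have h2 : (star 𝒜 u).card = 2 := by have := hS u huS; omega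
      have hXu : X ∈ star 𝒜 u := mem_star.2 ⟨hX, huX⟩
      obtain ⟨Z, hZ⟩ := card_eq_one.1 (show ((star 𝒜 u).erase X).card = 1 by
        rw [card_erase_of_mem hXu, h2])
      have hZm : Z ∈ (star 𝒜 u).erase X := by simp [hZ]
      have hst : star 𝒜 u = {X, Z} := by rw [← insert_erase hXu, hZ]
      rw [mem_erase, mem_star] at hZm
      exact ⟨Z, mem_filter.2 ⟨hZm.2.1, u, huS, huc, hZm.1.symm, hst⟩, hZm.1.symm, hst⟩
    choose! f hfP hne hst using hex
    refine card_le_card_of_injOn f hfP fun u hu w hw huw => ?_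
    by_contra hne'
    have mem : ∀ u ∈ L, ∀ B ∈ ({X, f u} : Finset (Finset V)), B ∈ 𝒜 ∧ u ∈ B := fun u hu B hB =>
      mem_star.1 (by rwa [hst u hu])
    have a := mem u hu (f u) (by simp)
    have b := mem w hw (f u) (by simp [huw])
    exact hne u hu (hl X hX (f u) a.1 u w (mem u hu X (by simp)).2 a.2
      (mem w hw X (by simp)).2 b.2 hne')
  exact (card_le_card h1).trans (card_image_le.trans ((card_union_le _ _).trans (by omega)))

theorem ProperOn.exists_insert_of_swap {𝒜 : Finset (Finset V)} {S : Finset V} {χ : V → Fin k}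
    (h : ProperOn 𝒜 S χ) {v u : V} (hv : v ∉ S) {X Y Z : Finset V} (hX : X ∈ 𝒜)
    (hvs : star 𝒜 v = {X, Y}) (hu : u ∈ S) (hus : star 𝒜 u = {X, Z})
    (huY : χ u ∈ missing S χ Y) {c : Fin k} (hcX : c ∈ missing S χ X)
    (hcZ : c ∈ missing S χ Z) (huX : u ∈ X) (huY' : u ∉ Y) :
    ∃ χ' : V → Fin k, ProperOn 𝒜 (insert v S) χ' := by
  have hcu := mem_missing.1 hcX u huX hu
  have h' := h.recolor hu (c := c) (by rw [hus]; simp [hcX, hcZ])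
  refine ⟨_, h'.update_insert hv (c := χ u) ?_⟩
  rw [hvs]
  simp only [mem_insert, mem_singleton, forall_eq_or_imp, forall_eq]
  constructor
  · refine mem_missing.2 fun w hw hwS => ?_
    by_cases hwu : w = u
    · subst hwu; simpa using hcu.symm
    · rw [Function.update_of_ne hwu]
      exact fun he => hwu (h X hX w hw u huX hwS hu he)
  · refine mem_missing.2 fun w hw hwS => ?_
    rw [Function.update_of_ne (by rintro rfl; exact huY' hw)]
    exact mem_missing.1 huY w hw hwS

theorem Linear.exists_insert_of_eq_two {𝒜 : Finset (Finset V)} (hl : Linear 𝒜) {S : Finset V}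
    {χ : V → Fin k} (h : ProperOn 𝒜 S χ) {v : V} (hv : v ∉ S)
    (hd : (star 𝒜 v).card = 2) (hS : ∀ u ∈ S, 2 ≤ (star 𝒜 u).card)
    (hk : 3 * 𝒜.card ≤ 2 * k + 2) :
    ∃ χ' : V → Fin k, ProperOn 𝒜 (insert v S) χ' := by
  obtain ⟨X, Y, hXY, hvs⟩ := card_eq_two.1 hd
  have hvX : X ∈ 𝒜 ∧ v ∈ X := mem_star.1 (by simp [hvs])
  have hvY : Y ∈ 𝒜 ∧ v ∈ Y := mem_star.1 (by simp [hvs])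
  by_contra hno
  have hdis : Disjoint (missing S χ X) (missing S χ Y) := by
    refine disjoint_left.2 fun c hcX hcY => hno ⟨_, h.update_insert hv (c := c) ?_⟩
    rw [hvs]
    simp [hcX, hcY]
  have hp : ∀ A ∈ star 𝒜 v, (A ∩ S).card + (heavy 𝒜 S A).card + 2 ≤ 𝒜.card := by
    intro A hA
    rw [mem_star] at hA
    have h1 := hl.sum_card_star_le hA.1 (T := insert v (A ∩ S))
      (insert_subset hA.2 inter_subset_left)
    rw [sum_insert (by simp [hv]), hd] at h1
    have := card_inter_add_card_heavy_le hS A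
    omega
  have hpX := hp X (by simp [hvs])
  have hpY := hp Y (by simp [hvs])
  have hmX := card_missing h hvX.1
  have hmY := card_missing h hvY.1
  have hcX := hl.card_missing_le hS hvX.1 hdis
  have hcY := hl.card_missing_le hS hvY.1 hdis.symm
  set P := 𝒜.filter fun Z => ∃ u ∈ S, χ u ∈ missing S χ Y ∧ X ≠ Z ∧ star 𝒜 u = {X, Z} with hP
  set Q := 𝒜.filter fun Z => ∃ u ∈ S, χ u ∈ missing S χ X ∧ Y ≠ Z ∧ star 𝒜 u = {Y, Z} with hQ
  have hPQ : (P ∩ Q).Nonempty := by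
    rw [← card_pos]
    have h1 := card_union_add_card_inter P Q
    have h2 := card_le_card (union_subset (filter_subset _ _) (filter_subset _ _) : P ∪ Q ⊆ 𝒜)
    omega
  obtain ⟨Z, hZ⟩ := hPQ
  simp only [hP, hQ, mem_inter, mem_filter] at hZ
  obtain ⟨⟨hZ, u, hu, huY, hXZ, hus⟩, -, w, hw, hwX, hYZ, hws⟩ := hZ
  have huX : u ∈ X := (mem_star.1 (by rw [hus]; simp : X ∈ star 𝒜 u)).2
  have hwY : w ∈ Y := (mem_star.1 (by rw [hws]; simp : Y ∈ star 𝒜 w)).2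
  have huY' : u ∉ Y := fun hh => mem_missing.1 huY u hh hu rfl
  have hwX' : w ∉ X := fun hh => mem_missing.1 hwX w hh hw rfl
  have hZX : Disjoint (missing S χ X) (missing S χ Z) := disjoint_left.2 fun c h1 h2 =>
    hno (h.exists_insert_of_swap hv hvX.1 hvs hu hus huY h1 h2 huX huY')
  have hZY : Disjoint (missing S χ Y) (missing S χ Z) := disjoint_left.2 fun c h1 h2 =>
    hno (h.exists_insert_of_swap hv hvY.1 (by rw [hvs, pair_comm]) hw hws hwX h1 h2 hwY hwX')
  have hmZ := card_missing h hZ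
  have hpZ := hl.sum_card_star_le hZ (inter_subset_left (s₂ := S))
  have hpZ' := card_inter_add_card_heavy_le hS Z
  have htot := card_le_univ ((missing S χ X ∪ missing S χ Y) ∪ missing S χ Z)
  rw [card_union_of_disjoint (disjoint_union_left.2 ⟨hZX, hZY⟩), card_union_of_disjoint hdis,
    Fintype.card_fin] at htot
  omega

/-- The Chang–Lawler bound: a linear family of `n` cliques of size at most `k` can be properly
colored with `k` colors as soon as `k ≥ 3n/2 - 1`. -/
theorem Linear.exists_properOn {𝒜 : Finset (Finset V)} (hl : Linear 𝒜) (hk0 : 0 < k)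
    (hA : ∀ A ∈ 𝒜, A.card ≤ k) (hk : 3 * 𝒜.card ≤ 2 * k + 2) (S : Finset V) :
    ∃ χ : V → Fin k, ProperOn 𝒜 S χ := by
  induction S using Finset.strongInduction with
  | H S ih =>
    rcases S.eq_empty_or_nonempty with rfl | hne
    · exact ⟨fun _ => ⟨0, hk0⟩, by simp [ProperOn]⟩
    obtain ⟨v, hv, hmin⟩ := exists_min_image S (fun u => (star 𝒜 u).card) hne
    obtain ⟨χ, hχ⟩ := ih _ (erase_ssubset hv)
    have hv' := notMem_erase v S
    have hmin' : ∀ u ∈ S.erase v, (star 𝒜 v).card ≤ (star 𝒜 u).card := fun u hu =>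
      hmin u (mem_of_mem_erase hu)
    rw [← insert_erase hv]
    rcases (by omega : (star 𝒜 v).card = 0 ∨ (star 𝒜 v).card = 1 ∨ (star 𝒜 v).card = 2 ∨
      3 ≤ (star 𝒜 v).card) with h0 | h1 | h2 | h3
    · apply hχ.exists_insert hv'
      rw [card_eq_zero.1 h0]
      simpa using hk0
    · apply hχ.exists_insert hv'
      obtain ⟨A, hAv⟩ := card_eq_one.1 h1
      have hA' := mem_star.1 (by rw [hAv]; simp : A ∈ star 𝒜 v)
      rw [hAv, sum_singleton]
      refine (card_lt_card ?_).trans_le (hA A hA'.1)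
      exact (ssubset_iff_of_subset inter_subset_left).2 ⟨v, hA'.2, by simp⟩
    · exact hl.exists_insert_of_eq_two hχ hv' h2 (fun u hu => h2 ▸ hmin' u hu) hk
    · exact hl.exists_insert_of_three_le hχ hv' h3 hmin' hk

end CliqueSystem

/-- For `2 < q < e < q²`, every graph that is the union of `e` `q`-cliques pairwise sharing
at most one vertex (a `(q,2)`-system) has chromatic number less than `3e/2`. -/
theorem stmt4 (q e : ℕ) (h1 : 2 < q) (h2 : q < e) (h3 : e < q ^ 2)
    (V : Type) [DecidableEq V] (𝒜 : Finset (Finset V))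
    (hsys : IsSystem 1 q 𝒜) (hcard : 𝒜.card = e) :
    ∃ n : ℕ, (n : ℝ) < 3 * e / 2 ∧ SysColorable 2 n 𝒜 := by
  have hl : CliqueSystem.Linear 𝒜 := by
    intro A hA B hB u w huA huB hwA hwB huw
    by_contra hne
    exact huw (Finset.card_le_one.1 (hsys.2 A hA B hB hne) u (Finset.mem_inter.2 ⟨huA, huB⟩) w
      (Finset.mem_inter.2 ⟨hwA, hwB⟩))
  refine ⟨(3 * e - 1) / 2, ?_, ?_⟩
  · have : 2 * ((3 * e - 1) / 2) < 3 * e := by omega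
    have h : (2 * ((3 * e - 1) / 2 : ℕ) : ℝ) < 3 * e := by exact_mod_cast this
    linarith
  · obtain ⟨χ, hχ⟩ := hl.exists_properOn (k := (3 * e - 1) / 2) (by omega)
      (fun A hA => by rw [hsys.1 A hA]; omega) (by omega) (𝒜.biUnion id)
    refine ⟨χ, fun A hA S hS hS2 => ?_⟩
    obtain ⟨u, w, huw, rfl⟩ := Finset.card_eq_two.1 hS2
    have hu : u ∈ A := hS (by simp)
    have hw : w ∈ A := hS (by simp)
    exact ⟨u, by simp, w, by simp, fun he => huw (hχ A hA u hu w hw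
      (Finset.mem_biUnion.2 ⟨A, hA, hu⟩) (Finset.mem_biUnion.2 ⟨A, hA, hw⟩) he)⟩
end

section
/- For every ε > 0 there is an integer q₀ such that for all integers q ≥ q₀ and e with q ≤ e ≤ q², there exists a graph that is the union of e cliques of size q, any two of which share at most one vertex, whose chromatic number is at least (1 − ε)·e. -/
section PrimePowers

open Filter Topology ArithmeticFunction

theorem exists_continuousOn_LSeries_vonMangoldt_sub_zeta :
    ∃ F : ℂ → ℂ, ContinuousOn F {s | 1 ≤ s.re} ∧ ∀ s : ℂ, 1 < s.re →
      F s = LSeries ((fun n ↦ (vonMangoldt n : ℂ)) - 1) s := by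
  classical
  let G : ℂ → ℂ := Function.update (fun s ↦ riemannZeta s - 1 / (s - 1)) 1
    Real.eulerMascheroniConstant
  have hG : Continuous G := by
    rw [← continuousOn_univ, continuousOn_update_iff]
    constructor
    · intro s hs
      have hs1 : s ≠ 1 := by simpa using hs
      refine ContinuousAt.continuousWithinAt ?_
      refine (differentiableAt_riemannZeta hs1).continuousAt.sub ?_
      exact continuousAt_const.div (by fun_prop) (sub_ne_zero.2 hs1)
    · intro _
      have := tendsto_riemannZeta_sub_one_div
      rwa [Set.compl_eq_univ_sdiff] at this
  refine ⟨fun s ↦ vonMangoldt.LFunctionResidueClassAux (q := 1) 1 s - G s,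
    (vonMangoldt.continuousOn_LFunctionResidueClassAux 1).sub hG.continuousOn, fun s hs ↦ ?_⟩
  have hs1 : s ≠ 1 := by rintro rfl; simp at hs
  have h1 := vonMangoldt.eqOn_LFunctionResidueClassAux (q := 1) (a := 1) isUnit_one hs
  have h2 : (fun n ↦ (vonMangoldt.residueClass (1 : ZMod 1) n : ℂ)) =
      fun n ↦ (vonMangoldt n : ℂ) := by
    funext n
    rw [vonMangoldt.residueClass, Set.indicator_of_mem]
    exact Subsingleton.elim _ _
  simp only [h1]
  rw [h2, LSeries_sub (LSeriesSummable_vonMangoldt hs) (LSeriesSummable_one_iff.2 hs),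
    LSeries_one_eq_riemannZeta hs]
  simp [G, hs1]

/-- The Fejér kernel `2 (1 - cos u) / u ^ 2`, extended by `1` at the origin. -/
noncomputable def fejerKernel (u : ℝ) : ℝ := if u = 0 then 1 else 2 * (1 - Real.cos u) / u ^ 2

theorem fejerKernel_nonneg (u : ℝ) : 0 ≤ fejerKernel u := by
  unfold fejerKernel
  split_ifs
  · exact zero_le_one
  · have := Real.cos_le_one u
    exact div_nonneg (by linarith) (sq_nonneg u)

theorem fejerKernel_le_one (u : ℝ) : fejerKernel u ≤ 1 := by
  unfold fejerKernel
  split_ifs with h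
  · exact le_rfl
  · rw [div_le_one (by positivity)]
    have := Real.one_sub_sq_div_two_le_cos (x := u)
    linarith

theorem fejerKernel_le_four_div_sq {u : ℝ} (hu : u ≠ 0) : fejerKernel u ≤ 4 / u ^ 2 := by
  rw [fejerKernel, if_neg hu]
  gcongr
  linarith [Real.neg_one_le_cos u]

theorem one_quarter_le_fejerKernel {u : ℝ} (hu : |u| ≤ 1) : 1 / 4 ≤ fejerKernel u := by
  unfold fejerKernel
  split_ifs with h
  · norm_num
  · have h1 := Real.cos_le_one_sub_mul_cos_sq (x := u) (hu.trans (by linarith [Real.pi_gt_three]))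
    have h2 : 1 / 8 ≤ 2 / Real.pi ^ 2 := by
      rw [div_le_div_iff₀ (by norm_num) (by positivity)]
      nlinarith [Real.pi_lt_four, Real.pi_pos]
    rw [le_div_iff₀ (by positivity)]
    nlinarith [sq_nonneg u]

open Complex in
theorem integral_triangle_mul_exp (u : ℝ) :
    ∫ t in (-1 : ℝ)..1, ((1 - |t| : ℝ) : ℂ) * exp (I * (u * t)) = fejerKernel u := by
  have hintegrable (a b : ℝ) : IntervalIntegrable
      (fun t : ℝ ↦ ((1 - |t| : ℝ) : ℂ) * exp (I * (u * t))) MeasureTheory.volume a b :=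
    Continuous.intervalIntegrable (by fun_prop) _ _
  rw [← intervalIntegral.integral_add_adjacent_intervals (hintegrable (-1) 0) (hintegrable 0 1)]
  have e1 : ∫ t in (-1 : ℝ)..0, ((1 - |t| : ℝ) : ℂ) * exp (I * (u * t)) =
      ∫ t in (-1 : ℝ)..0, (1 + t : ℂ) * exp (I * (u * t)) := by
    refine intervalIntegral.integral_congr fun t ht ↦ ?_
    rw [Set.uIcc_of_le (by norm_num)] at ht
    simp [abs_of_nonpos ht.2]
  have e2 : ∫ t in (0 : ℝ)..1, ((1 - |t| : ℝ) : ℂ) * exp (I * (u * t)) =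
      ∫ t in (0 : ℝ)..1, (1 - t : ℂ) * exp (I * (u * t)) := by
    refine intervalIntegral.integral_congr fun t ht ↦ ?_
    rw [Set.uIcc_of_le (by norm_num)] at ht
    simp [abs_of_nonneg ht.1]
  rw [e1, e2]
  have hd (P Q : ℂ) (t : ℝ) : HasDerivAt
      (fun t : ℝ ↦ (P + Q * t) * exp (I * (u * t)))
      (Q * exp (I * (u * t)) + (P + Q * t) * (exp (I * (u * t)) * (I * u))) t := by
    have hid : HasDerivAt (fun t : ℝ ↦ (t : ℂ)) 1 t := Complex.ofRealCLM.hasDerivAt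
    have h1 := (hid.const_mul Q).const_add P
    have h2 := ((hid.const_mul (u : ℂ)).const_mul I).cexp
    exact (h1.mul h2).congr_deriv (by ring)
  by_cases hu : u = 0
  · subst hu
    have d1 (t : ℝ) : HasDerivAt (fun t : ℝ ↦ (t + t ^ 2 / 2 : ℂ)) (1 + t) t := by
      have hid : HasDerivAt (fun t : ℝ ↦ (t : ℂ)) 1 t := Complex.ofRealCLM.hasDerivAt
      exact (hid.add ((hid.pow 2).div_const 2)).congr_deriv (by simp)
    have d2 (t : ℝ) : HasDerivAt (fun t : ℝ ↦ (t - t ^ 2 / 2 : ℂ)) (1 - t) t := by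
      have hid : HasDerivAt (fun t : ℝ ↦ (t : ℂ)) 1 t := Complex.ofRealCLM.hasDerivAt
      exact (hid.sub ((hid.pow 2).div_const 2)).congr_deriv (by simp)
    simp only [ofReal_zero, zero_mul, mul_zero, exp_zero, mul_one]
    rw [intervalIntegral.integral_eq_sub_of_hasDerivAt (fun t _ ↦ d1 t)
        (Continuous.intervalIntegrable (by fun_prop) _ _),
      intervalIntegral.integral_eq_sub_of_hasDerivAt (fun t _ ↦ d2 t)
        (Continuous.intervalIntegrable (by fun_prop) _ _)]
    norm_num [fejerKernel]
  · have hu' : (u : ℂ) ≠ 0 := by exact_mod_cast hu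
    have d1 (t : ℝ) : HasDerivAt
        (fun t : ℝ ↦ ((1 / (I * u) - 1 / (I * u) ^ 2) + 1 / (I * u) * t) * exp (I * (u * t)))
        ((1 + t) * exp (I * (u * t))) t := by
      convert hd _ _ t using 1
      field_simp
      ring
    have d2 (t : ℝ) : HasDerivAt
        (fun t : ℝ ↦ ((1 / (I * u) + 1 / (I * u) ^ 2) + (-1 / (I * u)) * t) * exp (I * (u * t)))
        ((1 - t) * exp (I * (u * t))) t := by
      convert hd _ _ t using 1
      field_simp
      ring
    rw [intervalIntegral.integral_eq_sub_of_hasDerivAt (fun t _ ↦ d1 t)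
        (Continuous.intervalIntegrable (by fun_prop) _ _),
      intervalIntegral.integral_eq_sub_of_hasDerivAt (fun t _ ↦ d2 t)
        (Continuous.intervalIntegrable (by fun_prop) _ _)]
    rw [fejerKernel, if_neg hu]
    push_cast
    rw [Complex.cos]
    simp only [mul_zero, exp_zero, mul_neg, mul_one]
    rw [show I * (u : ℂ) = u * I by ring, show -(u : ℂ) * I = -(u * I) by ring]
    field_simp
    simp only [I_sq]
    ring

open Complex in
theorem hasSum_term_mul_fejerKernel {f : ℕ → ℂ} {σ : ℝ} (hf : LSeriesSummable f σ) (r c : ℝ) :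
    HasSum (fun n ↦ LSeries.term f σ n * fejerKernel (r * (c - Real.log n)))
      (∫ t in (-1 : ℝ)..1, ((1 - |t| : ℝ) : ℂ) * exp (I * (r * c * t)) *
        LSeries f (σ + I * (r * t))) := by
  have hterm (n : ℕ) (t : ℝ) : ((1 - |t| : ℝ) : ℂ) * exp (I * (r * c * t)) *
      LSeries.term f (σ + I * (r * t)) n =
      LSeries.term f σ n * (((1 - |t| : ℝ) : ℂ) *
        exp (I * ((r * (c - Real.log n) : ℝ) * t))) := by
    rcases eq_or_ne n 0 with rfl | hn
    · simp
    · have hn' : (n : ℂ) ≠ 0 := by exact_mod_cast hn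
      rw [LSeries.term_of_ne_zero hn, LSeries.term_of_ne_zero hn, cpow_add _ _ hn',
        show I * ((r * (c - Real.log n) : ℝ) * (t : ℂ)) =
          I * (r * c * t) - Complex.log n * (I * (r * t)) by
            rw [← Complex.natCast_log]; push_cast; ring, Complex.exp_sub,
        cpow_def_of_ne_zero hn' (I * (r * t))]
      field_simp
  have hre (t : ℝ) : ((σ : ℂ) + I * (r * t)).re = σ := by simp
  have hnorm (n : ℕ) (t : ℝ) :
      ‖LSeries.term f (σ + I * (r * t)) n‖ = ‖LSeries.term f σ n‖ := by
    simp only [LSeries.norm_term_eq, hre, ofReal_re]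
  have hsum (t : ℝ) : LSeriesSummable f (σ + I * (r * t)) := by
    refine hf.of_re_le_re ?_
    rw [hre, ofReal_re]
  have key := intervalIntegral.hasSum_integral_of_dominated_convergence
    (μ := MeasureTheory.volume) (a := -1) (b := 1)
    (F := fun (n : ℕ) (t : ℝ) ↦ ((1 - |t| : ℝ) : ℂ) * exp (I * (r * c * t)) *
      LSeries.term f (σ + I * (r * t)) n)
    (f := fun t : ℝ ↦ ((1 - |t| : ℝ) : ℂ) * exp (I * (r * c * t)) *
        LSeries f (σ + I * (r * t)))
    (fun n _ ↦ ‖LSeries.term f σ n‖)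
    (fun n ↦ by
      simp_rw [hterm]
      exact Continuous.aestronglyMeasurable (by fun_prop))
    (fun n ↦ Eventually.of_forall fun t ht ↦ by
      rw [Set.uIoc_of_le (by norm_num)] at ht
      have h1 : ‖((1 - |t| : ℝ) : ℂ)‖ ≤ 1 := by
        rw [norm_real, Real.norm_eq_abs, abs_le]
        have := abs_le.2 ⟨ht.1.le, ht.2⟩
        constructor <;> linarith [abs_nonneg t]
      have h2 : ‖exp (I * (r * c * t))‖ = 1 := by
        rw [mul_comm]; exact_mod_cast norm_exp_ofReal_mul_I (r * c * t)
      rw [norm_mul, norm_mul, h2, hnorm, mul_one]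
      exact mul_le_of_le_one_left (norm_nonneg _) h1)
    (Eventually.of_forall fun t _ ↦ hf.norm)
    intervalIntegrable_const
    (Eventually.of_forall fun t _ ↦ (hsum t).hasSum.mul_left _)
  simpa only [hterm, intervalIntegral.integral_const_mul, integral_triangle_mul_exp] using key

open Complex in
theorem sum_fejerKernel_le {F : ℂ → ℂ} (hF : ContinuousOn F {s | 1 ≤ s.re})
    (hFL : ∀ s : ℂ, 1 < s.re → F s = LSeries ((fun n ↦ (vonMangoldt n : ℂ)) - 1) s)
    {r c T : ℝ}
    (hT : ∀ s : Finset ℕ, ∑ n ∈ s, vonMangoldt n / n * fejerKernel (r * (c - Real.log n)) ≤ T)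
    (S : Finset ℕ) :
    ∑ n ∈ S, 1 / (n : ℝ) * fejerKernel (r * (c - Real.log n)) ≤
      T + ‖∫ t in (-1 : ℝ)..1, ((1 - |t| : ℝ) : ℂ) * exp (I * (r * c * t)) *
        F (1 + I * (r * t))‖ := by
  set K : ℕ → ℝ := fun n ↦ fejerKernel (r * (c - Real.log n)) with hK
  have hK0 (n : ℕ) : 0 ≤ K n := fejerKernel_nonneg _
  let J : ℝ → ℂ := fun σ ↦ ∫ t in (-1 : ℝ)..1, ((1 - |t| : ℝ) : ℂ) * exp (I * (r * c * t)) *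
        F (max 1 σ + I * (r * t))
  have hJ : Continuous J := by
    refine intervalIntegral.continuous_parametric_intervalIntegral_of_continuous' ?_ _ _
    have hFc : Continuous (fun p : ℝ × ℝ ↦ F (max 1 p.1 + I * (r * p.2))) := by
      refine hF.comp_continuous (by fun_prop) fun p ↦ ?_
      simp
    unfold Function.uncurry
    exact Continuous.mul (by fun_prop) hFc
  have hσ (σ : ℝ) (h1 : 1 < σ) : ∑ n ∈ S, 1 / (n : ℝ) ^ σ * K n ≤ T + ‖J σ‖ := by
    have hre : 1 < (σ : ℂ).re := by simpa using h1
    have hJσ : J σ = ∫ t in (-1 : ℝ)..1, ((1 - |t| : ℝ) : ℂ) * exp (I * (r * c * t)) *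
        LSeries ((fun n ↦ (vonMangoldt n : ℂ)) - 1) (σ + I * (r * t)) := by
      refine intervalIntegral.integral_congr fun t _ ↦ ?_
      rw [max_eq_right h1.le, hFL _ (by simpa using h1)]
    have hterm (g : ℕ → ℝ) (n : ℕ) :
        LSeries.term (fun n ↦ (g n : ℂ)) σ n * K n = ((g n / (n : ℝ) ^ σ * K n : ℝ) : ℂ) := by
      rcases eq_or_ne n 0 with rfl | hn
      · simp [Real.zero_rpow (by linarith : σ ≠ 0)]
      · rw [LSeries.term_of_ne_zero hn]
        push_cast
        rw [Complex.ofReal_cpow n.cast_nonneg]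
        simp
    have hs1 := (hasSum_term_mul_fejerKernel (LSeriesSummable_vonMangoldt hre) r c)
    have hs2 := (hasSum_term_mul_fejerKernel (LSeriesSummable_one_iff.2 hre) r c)
    have hs3 := (hasSum_term_mul_fejerKernel
      ((LSeriesSummable_vonMangoldt hre).sub (LSeriesSummable_one_iff.2 hre)) r c)
    rw [← hJσ] at hs3
    have hsum1 : Summable fun n : ℕ ↦ vonMangoldt n / (n : ℝ) ^ σ * K n := by
      have := hs1.summable
      rw [← Complex.summable_ofReal]
      exact this.congr fun n ↦ hterm (fun n ↦ vonMangoldt n) n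
    have hsum2 : Summable fun n : ℕ ↦ 1 / (n : ℝ) ^ σ * K n := by
      have := hs2.summable
      rw [← Complex.summable_ofReal]
      refine this.congr fun n ↦ Eq.trans ?_ (hterm (fun _ ↦ 1) n)
      simp [Pi.one_def, hK]
    have hJeq : J σ = ((∑' n : ℕ, vonMangoldt n / (n : ℝ) ^ σ * K n -
        ∑' n : ℕ, 1 / (n : ℝ) ^ σ * K n : ℝ) : ℂ) := by
      rw [← hsum1.tsum_sub hsum2, ofReal_tsum]
      rw [← hs3.tsum_eq]
      refine tsum_congr fun n ↦ ?_
      rw [← sub_mul, ← sub_div, ← hterm (fun n ↦ vonMangoldt n - 1) n]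
      simp only [hK]
      congr 2
      funext n
      simp
    have hle1 : ∑' n : ℕ, vonMangoldt n / (n : ℝ) ^ σ * K n ≤ T := by
      refine hsum1.tsum_le_of_sum_le fun s ↦ le_trans (Finset.sum_le_sum fun n _ ↦ ?_) (hT s)
      rcases Nat.eq_zero_or_pos n with rfl | hn
      · simp
      · refine mul_le_mul_of_nonneg_right ?_ (hK0 n)
        have hn1 : (1 : ℝ) ≤ n := by exact_mod_cast hn
        refine div_le_div_of_nonneg_left vonMangoldt_nonneg (by linarith) ?_
        simpa using Real.rpow_le_rpow_of_exponent_le hn1 h1.le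
    have hle2 : ∑ n ∈ S, 1 / (n : ℝ) ^ σ * K n ≤ ∑' n : ℕ, 1 / (n : ℝ) ^ σ * K n :=
      hsum2.sum_le_tsum S fun n _ ↦ mul_nonneg (by positivity) (hK0 n)
    have hnorm : -‖J σ‖ ≤ ∑' n : ℕ, vonMangoldt n / (n : ℝ) ^ σ * K n -
        ∑' n : ℕ, 1 / (n : ℝ) ^ σ * K n := by
      rw [hJeq, norm_real, Real.norm_eq_abs]
      exact neg_abs_le _
    linarith
  have hlim1 : Tendsto (fun σ : ℝ ↦ ∑ n ∈ S, 1 / (n : ℝ) ^ σ * K n) (𝓝[>] 1)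
      (𝓝 (∑ n ∈ S, 1 / (n : ℝ) * K n)) := by
    refine tendsto_finsetSum _ fun n _ ↦ Tendsto.mul_const _ ?_
    refine Tendsto.mono_left ?_ nhdsWithin_le_nhds
    rcases Nat.eq_zero_or_pos n with rfl | hn
    · refine tendsto_const_nhds.congr' ?_
      filter_upwards [eventually_ne_nhds (one_ne_zero : (1 : ℝ) ≠ 0)] with σ hσ
      simp [Real.zero_rpow hσ]
    · have hn0 : (n : ℝ) ≠ 0 := by exact_mod_cast hn.ne'
      have : ContinuousAt (fun σ : ℝ ↦ (n : ℝ) ^ σ) 1 := Real.continuousAt_const_rpow hn0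
      simpa using this.tendsto.inv₀ (by simpa using hn0)
  have hlim2 : Tendsto (fun σ : ℝ ↦ T + ‖J σ‖) (𝓝[>] 1) (𝓝 (T + ‖J 1‖)) :=
    ((continuous_const.add hJ.norm).tendsto 1).mono_left nhdsWithin_le_nhds
  have := le_of_tendsto_of_tendsto hlim1 hlim2
    (eventually_nhdsWithin_of_forall fun σ h ↦ hσ σ h)
  simpa [J] using this

open Complex in
theorem tendsto_integral_mul_exp_mul_atTop (g H : ℝ → ℂ) {r : ℝ} (hr : 0 < r) :
    Tendsto (fun c : ℝ ↦ ∫ t in (-1 : ℝ)..1, g t * exp (I * (r * c * t)) * H t) atTop (𝓝 0) := by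
  have h := Real.tendsto_integral_exp_smul_cocompact
    (Set.indicator (Set.Ioc (-1 : ℝ) 1) fun t ↦ g t * H t)
  have hlim : Tendsto (fun c : ℝ ↦ -(r / (2 * Real.pi)) * c) atTop (cocompact ℝ) := by
    refine (tendsto_id.const_mul_atTop_of_neg ?_).mono_right atBot_le_cocompact
    have := Real.pi_pos
    simp only [Left.neg_neg_iff]
    positivity
  refine (h.comp hlim).congr fun c ↦ ?_
  rw [intervalIntegral.integral_of_le (by norm_num),
    ← MeasureTheory.integral_indicator measurableSet_Ioc]
  refine MeasureTheory.integral_congr_ae (Eventually.of_forall fun t ↦ ?_)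
  by_cases ht : t ∈ Set.Ioc (-1 : ℝ) 1
  · simp only [Set.indicator_of_mem ht]
    rw [Circle.smul_def, Real.fourierChar_apply, smul_eq_mul,
      show ((2 * Real.pi * -(t * (-(r / (2 * Real.pi)) * c)) : ℝ) : ℂ) * I = I * (r * c * t) by
        have : (Real.pi : ℂ) ≠ 0 := by exact_mod_cast Real.pi_ne_zero
        push_cast
        field_simp]
    ring
  · simp only [Set.indicator_of_notMem ht, smul_zero]

theorem summable_int_one_div_one_add_sq : Summable fun j : ℤ ↦ 1 / (1 + (j : ℝ) ^ 2) := by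
  refine Summable.of_norm_bounded_eventually (Real.summable_one_div_int_pow.2 one_lt_two) ?_
  have : ({0}ᶜ : Set ℤ) ∈ cofinite := (Set.finite_singleton 0).compl_mem_cofinite
  filter_upwards [this] with j hj
  have hj0 : (j : ℝ) ≠ 0 := by exact_mod_cast hj
  rw [Real.norm_of_nonneg (by positivity)]
  gcongr
  linarith

theorem sum_vonMangoldt_div_le {k : ℕ} {s : Finset ℕ}
    (hs : ∀ n ∈ s, Real.exp k ≤ n ∧ n ≤ Real.exp (k + 1)) :
    ∑ n ∈ s, vonMangoldt n / n ≤ (Real.log 4 + 4) * Real.exp 1 := by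
  have h1 : ∑ n ∈ s, vonMangoldt n ≤ Chebyshev.psi (Real.exp (k + 1)) := by
    rw [Chebyshev.psi]
    refine Finset.sum_le_sum_of_subset_of_nonneg (fun n hn ↦ ?_) fun _ _ _ ↦ vonMangoldt_nonneg
    have := hs n hn
    rw [Finset.mem_Ioc]
    refine ⟨?_, Nat.le_floor this.2⟩
    have := (Real.exp_pos k).trans_le this.1
    exact_mod_cast this
  calc ∑ n ∈ s, vonMangoldt n / n ≤ ∑ n ∈ s, vonMangoldt n / Real.exp k :=
        Finset.sum_le_sum fun n hn ↦ div_le_div_of_nonneg_left vonMangoldt_nonneg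
          (Real.exp_pos _) (hs n hn).1
    _ = (∑ n ∈ s, vonMangoldt n) / Real.exp k := by rw [Finset.sum_div]
    _ ≤ (Real.log 4 + 4) * Real.exp 1 := by
        rw [div_le_iff₀ (Real.exp_pos _), mul_assoc, ← Real.exp_add, add_comm (1 : ℝ)]
        exact h1.trans (Chebyshev.psi_le_const_mul_self (Real.exp_pos _).le)

theorem exists_sum_vonMangoldt_div_mul_le :
    ∃ B : ℝ, 0 < B ∧ ∀ (c : ℝ) (s : Finset ℕ),
      ∑ n ∈ s, vonMangoldt n / n * (1 / (1 + (c - Real.log n) ^ 2)) ≤ B := by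
  set D : ℝ := (Real.log 4 + 4) * Real.exp 1 with hD
  have hD0 : 0 < D := by have := Real.log_pos (by norm_num : (1 : ℝ) < 4); positivity
  set Z : ℝ := ∑' j : ℤ, 1 / (1 + (j : ℝ) ^ 2) with hZ
  have hZ0 : 0 ≤ Z := tsum_nonneg fun j ↦ by positivity
  refine ⟨4 * D * Z + 1, by positivity, fun c s ↦ ?_⟩
  set κ : ℕ → ℕ := fun n ↦ ⌊Real.log n⌋₊
  set m : ℤ := ⌊c⌋
  have hblock (k : ℕ) : ∑ n ∈ s with κ n = k,
      vonMangoldt n / n * (1 / (1 + (c - Real.log n) ^ 2)) ≤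
      4 * D * (1 / (1 + (((k : ℤ) - m : ℤ) : ℝ) ^ 2)) := by
    have hlog (n : ℕ) (hn : κ n = k) : (k : ℝ) ≤ Real.log n ∧ Real.log n < k + 1 := by
      rw [← hn]
      exact ⟨Nat.floor_le (Real.log_natCast_nonneg n), Nat.lt_floor_add_one _⟩
    have hw (n : ℕ) (hn : κ n = k) : 1 / (1 + (c - Real.log n) ^ 2) ≤
        4 * (1 / (1 + (((k : ℤ) - m : ℤ) : ℝ) ^ 2)) := by
      obtain ⟨h1, h2⟩ := hlog n hn
      have h3 : (m : ℝ) ≤ c := Int.floor_le c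
      have h4 : c < m + 1 := Int.lt_floor_add_one c
      rw [← mul_div_assoc, mul_one, div_le_div_iff₀ (by positivity) (by positivity), one_mul]
      push_cast
      set v := c - Real.log n with hv
      set d := (k : ℝ) - m with hd
      have h5 : (d + v) ^ 2 ≤ 1 := by
        rw [sq_le_one_iff_abs_le_one, abs_le]
        constructor <;> linarith
      nlinarith [sq_nonneg (d + 2 * v)]
    calc ∑ n ∈ s with κ n = k, vonMangoldt n / n * (1 / (1 + (c - Real.log n) ^ 2))
        ≤ ∑ n ∈ s with κ n = k, vonMangoldt n / n *
            (4 * (1 / (1 + (((k : ℤ) - m : ℤ) : ℝ) ^ 2))) :=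
          Finset.sum_le_sum fun n hn ↦ mul_le_mul_of_nonneg_left
            (hw n (Finset.mem_filter.1 hn).2) (div_nonneg vonMangoldt_nonneg n.cast_nonneg)
      _ = ∑ n ∈ s with κ n = k ∧ n ≠ 0, vonMangoldt n / n *
            (4 * (1 / (1 + (((k : ℤ) - m : ℤ) : ℝ) ^ 2))) := by
          refine (Finset.sum_subset (fun n hn ↦ ?_) fun n hn hn' ↦ ?_).symm
          · simp only [Finset.mem_filter] at hn ⊢
            exact ⟨hn.1, hn.2.1⟩
          · simp only [Finset.mem_filter, not_and, not_not] at hn hn'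
            simp [hn' hn.1 hn.2]
      _ = (∑ n ∈ s with κ n = k ∧ n ≠ 0, vonMangoldt n / n) *
            (4 * (1 / (1 + (((k : ℤ) - m : ℤ) : ℝ) ^ 2))) := by rw [Finset.sum_mul]
      _ ≤ D * (4 * (1 / (1 + (((k : ℤ) - m : ℤ) : ℝ) ^ 2))) := by
          refine mul_le_mul_of_nonneg_right (sum_vonMangoldt_div_le (k := k) fun n hn ↦ ?_)
            (by positivity)
          simp only [Finset.mem_filter] at hn
          obtain ⟨h1, h2⟩ := hlog n hn.2.1
          have hn0 : (0 : ℝ) < n := by exact_mod_cast Nat.pos_of_ne_zero hn.2.2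
          rw [← Real.exp_log hn0]
          exact ⟨Real.exp_le_exp.2 h1, Real.exp_le_exp.2 h2.le⟩
      _ = _ := by ring
  rw [← Finset.sum_fiberwise_of_maps_to (t := s.image κ) (g := κ)
    fun n hn ↦ Finset.mem_image_of_mem κ hn]
  have hinj : Function.Injective fun k : ℕ ↦ (k : ℤ) - m := fun a b h ↦ by simpa using h
  calc _ ≤ ∑ k ∈ s.image κ, 4 * D * (1 / (1 + (((k : ℤ) - m : ℤ) : ℝ) ^ 2)) :=
        Finset.sum_le_sum fun k _ ↦ hblock k
    _ = 4 * D * ∑ k ∈ s.image κ, 1 / (1 + (((k : ℤ) - m : ℤ) : ℝ) ^ 2) := by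
        rw [Finset.mul_sum]
    _ = 4 * D * ∑ j ∈ (s.image κ).map ⟨_, hinj⟩, 1 / (1 + (j : ℝ) ^ 2) := by
        rw [Finset.sum_map]; rfl
    _ ≤ 4 * D * Z := by
        gcongr
        exact summable_int_one_div_one_add_sq.sum_le_tsum _ fun j _ ↦ by positivity
    _ ≤ _ := by linarith

theorem one_sub_exp_neg_sub_le_sum_Icc {c a : ℝ} (ha : 0 ≤ a) :
    1 - Real.exp (-a) - Real.exp (-c) ≤
      ∑ n ∈ Finset.Icc ⌈Real.exp c⌉₊ ⌊Real.exp (c + a)⌋₊, 1 / (n : ℝ) := by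
  set x := Real.exp c with hx
  set y := Real.exp (c + a) with hy
  have hx0 : 0 < x := Real.exp_pos _
  have hxy : x ≤ y := Real.exp_le_exp.2 (by linarith)
  have hy0 : 0 < y := Real.exp_pos _
  have hcard : y - x - 1 ≤ ((Finset.Icc ⌈x⌉₊ ⌊y⌋₊).card : ℝ) := by
    rw [Nat.card_Icc]
    have h1 : ((⌊y⌋₊ + 1 : ℕ) : ℝ) ≤ (⌊y⌋₊ + 1 - ⌈x⌉₊ : ℕ) + ⌈x⌉₊ := by
      exact_mod_cast le_tsub_add
    have h2 := Nat.lt_floor_add_one y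
    have h3 := Nat.ceil_lt_add_one hx0.le
    push_cast at h1
    linarith
  have hxe : x = y * Real.exp (-a) := by rw [hx, hy, ← Real.exp_add]; ring_nf
  have hye : 1 ≤ y * Real.exp (-c) := by
    rw [hy, ← Real.exp_add]
    exact Real.one_le_exp (by linarith)
  calc 1 - Real.exp (-a) - Real.exp (-c) ≤ (y - x - 1) * (1 / y) := by
        rw [mul_one_div, le_div_iff₀ hy0]
        nlinarith
    _ ≤ (Finset.Icc ⌈x⌉₊ ⌊y⌋₊).card * (1 / y) := by gcongr
    _ = ∑ n ∈ Finset.Icc ⌈x⌉₊ ⌊y⌋₊, 1 / y := by simp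
    _ ≤ _ := by
        refine Finset.sum_le_sum fun n hn ↦ ?_
        rw [Finset.mem_Icc] at hn
        have h1 : x ≤ n := Nat.ceil_le.1 hn.1
        exact one_div_le_one_div_of_le (hx0.trans_le h1) ((Nat.le_floor_iff hy0.le).1 hn.2)

theorem eventually_exists_isPrimePow {δ : ℝ} (hδ : 0 < δ) (hδ1 : δ ≤ 1) :
    ∀ᶠ c : ℝ in atTop, ∃ n : ℕ, IsPrimePow n ∧ |c - Real.log n| < δ := by
  obtain ⟨F, hF, hFL⟩ := exists_continuousOn_LSeries_vonMangoldt_sub_zeta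
  obtain ⟨B, hB, hsum⟩ := exists_sum_vonMangoldt_div_mul_le
  set r : ℝ := 1 + 128 * B / δ ^ 2 with hr
  have hr1 : 1 ≤ r := le_add_of_nonneg_right (by positivity)
  have hr0 : 0 < r := by linarith
  set J : ℝ → ℂ := fun c ↦ ∫ t in (-1 : ℝ)..1,
    ((1 - |t| : ℝ) : ℂ) * Complex.exp (Complex.I * (r * c * t)) * F (1 + Complex.I * (r * t))
  have hJ : Tendsto (fun c ↦ ‖J c‖ + Real.exp (-c)) atTop (𝓝 0) := by
    have h1 := (tendsto_integral_mul_exp_mul_atTop (fun t ↦ ((1 - |t| : ℝ) : ℂ))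
      (fun t ↦ F (1 + Complex.I * (r * t))) hr0).norm
    have h2 := h1.add Real.tendsto_exp_neg_atTop_nhds_zero
    rwa [norm_zero, add_zero] at h2
  have hsmall : (0 : ℝ) < 1 / (16 * r) := by positivity
  filter_upwards [hJ.eventually_lt_const hsmall] with c hc
  by_contra! hno
  have hT (s : Finset ℕ) :
      ∑ n ∈ s, vonMangoldt n / n * fejerKernel (r * (c - Real.log n)) ≤
        8 / (r ^ 2 * δ ^ 2) * B := by
    refine le_trans ?_ (mul_le_mul_of_nonneg_left (hsum c s) (by positivity))
    rw [Finset.mul_sum]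
    refine Finset.sum_le_sum fun n _ ↦ ?_
    by_cases hn : IsPrimePow n
    · have hv := hno n hn
      set v := c - Real.log n
      have hv2 : δ ^ 2 ≤ v ^ 2 := by rw [← sq_abs v]; gcongr
      have hv0 : v ≠ 0 := by rintro h; rw [h, abs_zero] at hv; linarith
      have h4 := fejerKernel_le_four_div_sq (mul_ne_zero hr0.ne' hv0)
      rw [mul_left_comm]
      refine mul_le_mul_of_nonneg_left (h4.trans ?_) (div_nonneg vonMangoldt_nonneg n.cast_nonneg)
      rw [div_mul_div_comm, div_le_div_iff₀ (by positivity) (by positivity), mul_pow]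
      have : δ ^ 2 * (1 + v ^ 2) ≤ 2 * v ^ 2 := by
        nlinarith [mul_le_mul_of_nonneg_right (pow_le_one₀ (n := 2) hδ.le hδ1) (sq_nonneg v)]
      nlinarith [sq_nonneg r, mul_le_mul_of_nonneg_left this (sq_nonneg r)]
    · have : vonMangoldt n = 0 := by
        by_contra h
        exact hn (vonMangoldt_ne_zero_iff.1 h)
      simp [this]
  have key := sum_fejerKernel_le hF hFL hT (Finset.Icc ⌈Real.exp c⌉₊ ⌊Real.exp (c + 1 / r)⌋₊)
  have hlow : 1 / 4 * (1 - Real.exp (-(1 / r)) - Real.exp (-c)) ≤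
      ∑ n ∈ Finset.Icc ⌈Real.exp c⌉₊ ⌊Real.exp (c + 1 / r)⌋₊,
        1 / (n : ℝ) * fejerKernel (r * (c - Real.log n)) := by
    refine (mul_le_mul_of_nonneg_left (one_sub_exp_neg_sub_le_sum_Icc (by positivity))
      (by norm_num)).trans ?_
    rw [Finset.mul_sum]
    refine Finset.sum_le_sum fun n hn ↦ ?_
    rw [Finset.mem_Icc] at hn
    have h1 : Real.exp c ≤ n := Nat.ceil_le.1 hn.1
    have h2 : (n : ℝ) ≤ Real.exp (c + 1 / r) := (Nat.le_floor_iff (Real.exp_pos _).le).1 hn.2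
    have hn0 : (0 : ℝ) < n := (Real.exp_pos c).trans_le h1
    rw [← Real.le_log_iff_exp_le hn0] at h1
    rw [← Real.log_le_iff_le_exp hn0] at h2
    rw [mul_comm]
    refine mul_le_mul_of_nonneg_left (one_quarter_le_fejerKernel ?_) (by positivity)
    rw [abs_mul, abs_of_pos hr0, abs_of_nonpos (by linarith)]
    calc r * -(c - Real.log n) ≤ r * (1 / r) := by gcongr; linarith
      _ = 1 := by field_simp
  have hexp : Real.exp (-(1 / r)) ≤ 1 - 1 / (2 * r) := by
    have hr' : 1 / r ≤ 1 := by rw [div_le_one hr0]; exact hr1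
    have h0 : 0 < 1 / r := by positivity
    have h1 := Real.add_one_le_exp (1 / r)
    have h2 : Real.exp (-(1 / r)) * Real.exp (1 / r) = 1 := by rw [← Real.exp_add]; simp
    have h3 := Real.exp_pos (-(1 / r))
    have h4 : 1 / (2 * r) = (1 / r) / 2 := by field_simp
    rw [h4]
    nlinarith
  have hBr : 8 / (r ^ 2 * δ ^ 2) * B ≤ 1 / (16 * r) := by
    rw [div_mul_eq_mul_div, div_le_div_iff₀ (by positivity) (by positivity)]
    have h1 : 128 * B ≤ r * δ ^ 2 := by
      have : 128 * B = 128 * B / δ ^ 2 * δ ^ 2 := by field_simp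
      rw [this]
      gcongr
      linarith
    nlinarith [mul_le_mul_of_nonneg_left h1 hr0.le]
  have e1 : 1 / (16 * r) = 1 / r / 16 := by field_simp
  have e2 : 1 / (2 * r) = 1 / r / 2 := by field_simp
  have := Real.exp_pos (-c)
  have : (0 : ℝ) < 1 / r := by positivity
  change _ ≤ _ + ‖J c‖ at key
  have := norm_nonneg (J c)
  rw [e1] at hc hBr
  rw [e2] at hexp
  linarith

theorem exists_isPrimePow_near_sqrt {ε : ℝ} (hε : 0 < ε) :
    ∃ e₀ : ℕ, ∀ e : ℕ, e₀ ≤ e →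
      ∃ P : ℕ, IsPrimePow P ∧ (P + 1) ^ 2 ≤ e ∧ (1 - ε) * e ≤ (P : ℝ) ^ 2 := by
  set δ : ℝ := min (1 / 4) (ε / 8) with hδ
  have hδ0 : 0 < δ := by positivity
  have hδ4 : δ ≤ 1 / 4 := min_le_left _ _
  have hδε : δ ≤ ε / 8 := min_le_right _ _
  have hlim : Tendsto (fun e : ℕ ↦ Real.log (√(e : ℝ) - 1) - δ) atTop atTop :=
    tendsto_atTop_add_const_right _ _ (Real.tendsto_log_atTop.comp
      (tendsto_atTop_add_const_right _ _
        (Real.tendsto_sqrt_atTop.comp tendsto_natCast_atTop_atTop)))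
  have hsqrt : Tendsto (fun e : ℕ ↦ √(e : ℝ)) atTop atTop :=
    Real.tendsto_sqrt_atTop.comp tendsto_natCast_atTop_atTop
  obtain ⟨e₀, he₀⟩ := eventually_atTop.1
    ((hlim.eventually (eventually_exists_isPrimePow hδ0 (hδ4.trans (by norm_num)))).and
      ((hsqrt.eventually_ge_atTop (4 / ε)).and (hsqrt.eventually_ge_atTop 2)))
  refine ⟨e₀, fun e he ↦ ?_⟩
  obtain ⟨⟨P, hP, hlog⟩, hs1, hs2⟩ := he₀ e he
  set s := √(e : ℝ) with hs
  have hse : s ^ 2 = e := Real.sq_sqrt e.cast_nonneg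
  have hP0 : (0 : ℝ) < P := by exact_mod_cast hP.pos
  have hs0 : 0 < s - 1 := by linarith
  rw [abs_lt] at hlog
  have hup : (P : ℝ) ≤ s - 1 :=
    (Real.log_le_log_iff hP0 hs0).1 (by linarith)
  have hlow : (s - 1) * (1 - 2 * δ) ≤ P := by
    have h1 : Real.log (s - 1) + -(2 * δ) ≤ Real.log P := by linarith
    have h2 := Real.exp_le_exp.2 h1
    rw [Real.exp_add, Real.exp_log hs0, Real.exp_log hP0] at h2
    have h3 := Real.add_one_le_exp (-(2 * δ))
    refine le_trans (mul_le_mul_of_nonneg_left ?_ hs0.le) h2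
    linarith
  have hPe : (P + 1) ^ 2 ≤ e := by
    have : ((P : ℝ) + 1) ^ 2 ≤ e := by
      rw [← hse]
      gcongr
      linarith
    exact_mod_cast this
  refine ⟨P, hP, hPe, ?_⟩
  have h2 : ((s - 1) * (1 - 2 * δ)) ^ 2 ≤ (P : ℝ) ^ 2 := by
    have : 0 ≤ 1 - 2 * δ := by linarith
    gcongr
  have h3 : (1 - ε / 2) ≤ (1 - 2 * δ) ^ 2 := by nlinarith
  have h4 : s ^ 2 - 2 * s ≤ (s - 1) ^ 2 := by nlinarith
  have h5 : 4 ≤ s * ε := by rwa [div_le_iff₀ hε] at hs1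
  rw [← hse]
  have h6 : 0 ≤ (s - 1) ^ 2 := sq_nonneg _
  have h7 : (s - 1) ^ 2 * (1 - ε / 2) ≤ (s - 1) ^ 2 * (1 - 2 * δ) ^ 2 :=
    mul_le_mul_of_nonneg_left h3 h6
  rw [mul_pow] at h2
  nlinarith [mul_le_mul_of_nonneg_left h5 (by linarith : 0 ≤ s)]

end PrimePowers

theorem exists_projectivePlane_lines {P : ℕ} (hP : IsPrimePow P) :
    ∃ (V ι : Type) (_ : Fintype V) (_ : Fintype ι) (_ : DecidableEq V) (A : ι → Finset V),
      Fintype.card V = P ^ 2 + P + 1 ∧ Fintype.card ι = P ^ 2 + P + 1 ∧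
      (∀ i, (A i).card = P + 1) ∧ (∀ i j, i ≠ j → (A i ∩ A j).card ≤ 1) ∧
      ∀ u v, u ≠ v → ∃ i, u ∈ A i ∧ v ∈ A i := by
  classical
  obtain ⟨p, k, hp, hk, rfl⟩ := (isPrimePow_nat_iff P).1 hP
  have : Fact p.Prime := ⟨hp⟩
  let K := GaloisField p k
  have hK : Nat.card K = p ^ k := GaloisField.card p k hk.ne'
  let V := Projectivization K (Fin 3 → K)
  have : Finite V := inferInstance
  let _ : Fintype V := Fintype.ofFinite V
  have hcard : Fintype.card V = (p ^ k) ^ 2 + p ^ k + 1 := by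
    rw [← Nat.card_eq_fintype_card,
      Projectivization.card_of_finrank K (Fin 3 → K) (n := 3) (by simp), hK]
    simp [Finset.sum_range_succ]
    ring
  have horder : Configuration.ProjectivePlane.order V V = p ^ k := by
    have h := Configuration.ProjectivePlane.card_points V V
    rw [hcard] at h
    nlinarith
  refine ⟨V, V, inferInstance, inferInstance, inferInstance,
    fun l ↦ Finset.univ.filter (· ∈ l), hcard, hcard, fun l ↦ ?_, fun l m hlm ↦ ?_,
    fun u v huv ↦ ?_⟩
  · have h := Configuration.ProjectivePlane.pointCount_eq (P := V) l
    rw [horder, Configuration.pointCount, Nat.card_eq_fintype_card, Fintype.card_subtype] at h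
    exact h
  · rw [Finset.card_le_one]
    intro a ha b hb
    simp only [Finset.mem_inter, Finset.mem_filter, Finset.mem_univ, true_and] at ha hb
    exact (Configuration.Nondegenerate.eq_or_eq ha.1 hb.1 ha.2 hb.2).resolve_right hlm
  · obtain ⟨l, hl, -⟩ := Configuration.HasLines.existsUnique_line V V u v huv
    exact ⟨l, by simpa using hl⟩

/-- A linear family of sets of size at most `q` extends, by adding private vertices, to a
family of `q`-cliques; every colouring of the latter is proper on the former. -/
theorem exists_isSystem_of_card_inter_le_one {V ι : Type} [Fintype V] [Fintype ι]
    [DecidableEq V] {q : ℕ} (hq : 2 ≤ q) (A : ι → Finset V) (hA : ∀ i, (A i).card ≤ q)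
    (hA1 : ∀ i j, i ≠ j → (A i ∩ A j).card ≤ 1) :
    ∃ (N : ℕ) (𝒜 : Finset (Finset (Fin N))),
      IsSystem 1 q 𝒜 ∧ 𝒜.card = Fintype.card ι ∧
      ∀ n : ℕ, SysColorable 2 n 𝒜 →
        ∃ χ : V → Fin n, ∀ i, ∀ u ∈ A i, ∀ v ∈ A i, u ≠ v → χ u ≠ χ v := by
  classical
  have hT (i : ι) : ∃ T : Finset (Fin q), T.card = q - (A i).card := by
    obtain ⟨T, -, hT⟩ := Finset.exists_subset_card_eq
      (s := (Finset.univ : Finset (Fin q))) (n := q - (A i).card) (by simp)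
    exact ⟨T, hT⟩
  choose T hT using hT
  let φ := Fintype.equivFin (V ⊕ ι × Fin q)
  let B : ι → Finset (Fin (Fintype.card (V ⊕ ι × Fin q))) := fun i ↦
    ((A i).disjSum ({i} ×ˢ T i)).map φ.toEmbedding
  have hBcard (i : ι) : (B i).card = q := by
    simp only [B, Finset.card_map, Finset.card_disjSum, Finset.card_product,
      Finset.card_singleton, hT, one_mul]
    have := hA i
    omega
  have hBinter (i j : ι) (hij : i ≠ j) : (B i ∩ B j).card ≤ 1 := by
    have : B i ∩ B j = ((A i ∩ A j).map Function.Embedding.inl).map φ.toEmbedding := by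
      simp only [B, ← Finset.map_inter]
      congr 1
      ext x
      rcases x with x | ⟨a, b⟩
      · simp
      · simp only [Finset.mem_inter, Finset.inr_mem_disjSum, Finset.mem_product,
          Finset.mem_singleton, Finset.mem_map, Function.Embedding.inl_apply, reduceCtorEq,
          and_false, exists_false, iff_false]
        rintro ⟨⟨rfl, -⟩, h, -⟩
        exact hij h
    rw [this, Finset.card_map, Finset.card_map]
    exact hA1 i j hij
  have hBinj : Function.Injective B := by
    intro i j h
    by_contra hij
    have := hBinter i j hij
    rw [← h, Finset.inter_self, hBcard] at this
    omega
  refine ⟨_, Finset.univ.image B, ⟨by simpa using hBcard, ?_⟩, ?_, ?_⟩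
  · simp only [Finset.mem_image, Finset.mem_univ, true_and]
    rintro _ ⟨i, rfl⟩ _ ⟨j, rfl⟩ h
    exact hBinter i j fun hij ↦ h (by rw [hij])
  · rw [Finset.card_image_of_injective _ hBinj, Finset.card_univ]
  · rintro n ⟨χ, hχ⟩
    refine ⟨fun v ↦ χ (φ (Sum.inl v)), fun i u hu v hv huv heq ↦ ?_⟩
    have hne : φ (Sum.inl u) ≠ φ (Sum.inl v) := by simpa using huv
    obtain ⟨x, hx, y, hy, hxy⟩ := hχ (B i) (Finset.mem_image_of_mem B (Finset.mem_univ i))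
      {φ (Sum.inl u), φ (Sum.inl v)}
      (by
        rw [Finset.insert_subset_iff, Finset.singleton_subset_iff]
        simp [B, hu, hv])
      (Finset.card_pair hne)
    simp only [Finset.mem_insert, Finset.mem_singleton] at hx hy
    rcases hx with rfl | rfl <;> rcases hy with rfl | rfl <;> simp_all

theorem exists_isSystem_of_isPrimePow {P q e : ℕ} (hP : IsPrimePow P) (hPq : P + 1 ≤ q)
    (hPe : P ^ 2 + P + 1 ≤ e) :
    ∃ (N : ℕ) (𝒜 : Finset (Finset (Fin N))),
      IsSystem 1 q 𝒜 ∧ 𝒜.card = e ∧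
      ∀ n : ℕ, SysColorable 2 n 𝒜 → P ^ 2 + P + 1 ≤ n := by
  obtain ⟨V, ι, _, _, _, A, hV, hι, hA, hA1, hline⟩ := exists_projectivePlane_lines hP
  have := hP.one_lt
  obtain ⟨N, 𝒜, h𝒜, hcard, hcol⟩ := exists_isSystem_of_card_inter_le_one (q := q) (by omega)
    (Sum.elim A fun _ : Fin (e - (P ^ 2 + P + 1)) ↦ ∅)
    (by rintro (i | i) <;> simp [hA, hPq])
    (by
      rintro (i | i) (j | j) h
      · exact hA1 i j (by simpa using h)
      all_goals simp)
  refine ⟨N, 𝒜, h𝒜, ?_, fun n hn ↦ ?_⟩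
  · rw [hcard, Fintype.card_sum, hι, Fintype.card_fin]
    omega
  · obtain ⟨χ, hχ⟩ := hcol n hn
    rw [← hV, ← Fintype.card_fin n]
    refine Fintype.card_le_of_injective χ fun u v h ↦ ?_
    by_contra huv
    obtain ⟨i, hu, hv⟩ := hline u v huv
    exact hχ (Sum.inl i) u hu v hv huv h

/-- For every `ε > 0` there is `q₀` such that for all `q ≥ q₀` and `q ≤ e ≤ q²` there is a
graph that is the union of `e` `q`-cliques pairwise sharing at most one vertex whose
chromatic number is at least `(1 - ε)·e`. -/
theorem stmt5 (ε : ℝ) (hε : 0 < ε) :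
    ∃ q₀ : ℕ, ∀ q : ℕ, q₀ ≤ q → ∀ e : ℕ, q ≤ e → e ≤ q ^ 2 →
      ∃ (N : ℕ) (𝒜 : Finset (Finset (Fin N))),
        IsSystem 1 q 𝒜 ∧ 𝒜.card = e ∧
        ∀ n : ℕ, SysColorable 2 n 𝒜 → (1 - ε) * e ≤ n := by
  obtain ⟨e₀, he₀⟩ := exists_isPrimePow_near_sqrt hε
  refine ⟨e₀, fun q hq e hqe heq ↦ ?_⟩
  obtain ⟨P, hP, hPe, hlow⟩ := he₀ e (hq.trans hqe)
  have hPq : P + 1 ≤ q := (Nat.pow_le_pow_iff_left two_ne_zero).1 (hPe.trans heq)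
  obtain ⟨N, 𝒜, h𝒜, hcard, hcol⟩ := exists_isSystem_of_isPrimePow hP hPq
    (le_trans (by nlinarith) hPe)
  refine ⟨N, 𝒜, h𝒜, hcard, fun n hn ↦ hlow.trans ?_⟩
  have := hcol n hn
  have : P ^ 2 ≤ n := by omega
  exact_mod_cast this
end

section
/- For every integer k ≥ 3 there exist a constant c > 0 and an integer q₀ such that for every integer q ≥ q₀ and every integer e with e > q^{2k+2}, there exists a 1-(q,k)-system consisting of e q-cliques whose chromatic number is at least c · e^{1/(2k−2)} · q^{1−2/(k−1)} · (log e)^{−1/(k−1)}. -/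
/-- Derandomised selection process: if at each stage the admissible choices make up at least half
of `Ω` and hit each unhit target with relative frequency at least `p`, as long as no test event
has occurred too often, then all targets can be hit within `e` choices. -/
theorem exists_list_hitting {Ω J S : Type*} [Fintype Ω] [DecidableEq Ω] [Nonempty Ω] [Fintype J]
    [Fintype S] [Nonempty S] (E : J → Finset Ω) (H : S → Finset Ω) (w ρ : J → ℝ) (p : ℝ) (e : ℕ)
    (Al : List Ω → Finset Ω) (P : List Ω → Prop) (hnil : P [])
    (hcons : ∀ L f, P L → f ∈ Al L → P (f :: L)) (hw : ∀ j, 0 < w j) (hw2 : ∑ j, w j ≤ 2)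
    (hp0 : 0 ≤ p)
    (hE : ∀ j, ((E j).card : ℝ) ≤ ρ j * Fintype.card Ω)
    (hp : 3 * (Fintype.card S : ℝ) < Real.exp (p * e))
    (hstep : ∀ L, P L → (∀ j, (L.countP (fun f => decide (f ∈ E j)) : ℝ) ≤
        Real.log (3 / w j) + 4 * ρ j * e) →
      (Fintype.card Ω : ℝ) ≤ 2 * (Al L).card ∧ ∀ s, (∀ f ∈ L, f ∉ H s) →
        p * Fintype.card Ω ≤ (Al L ∩ H s).card) :
    ∃ L : List Ω, L.length = e ∧ P L ∧ ∀ s, ∃ f ∈ L, f ∈ H s := by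
  classical
  have hΩ : (0 : ℝ) < Fintype.card Ω := by exact_mod_cast Fintype.card_pos
  have hS : (0 : ℝ) < Fintype.card S := by exact_mod_cast Fintype.card_pos
  have hρ : ∀ j, 0 ≤ ρ j := fun j => by
    by_contra h
    have h2 := hE j
    have : (0 : ℝ) ≤ (E j).card := by positivity
    nlinarith
  let a : List Ω → S → ℝ := fun L s =>
    if ∀ f ∈ L, f ∉ H s then Real.exp (p * L.length) else 0
  let b : List Ω → J → ℝ := fun L j =>
    w j * (Real.exp (L.countP (fun f => decide (f ∈ E j))) *
      Real.exp (-(4 * ρ j * L.length)))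
  let Φ : List Ω → ℝ := fun L => (∑ s, a L s) / Fintype.card S + ∑ j, b L j
  have ha0 : ∀ L s, 0 ≤ a L s := fun L s => by
    dsimp only [a]; split_ifs <;> positivity
  have hb0 : ∀ L j, 0 < b L j := fun L j => by
    have := hw j
    dsimp only [b]; positivity
  have hcount : ∀ L : List Ω, L.length ≤ e → Φ L ≤ 3 → ∀ j,
      (L.countP (fun f => decide (f ∈ E j)) : ℝ) ≤ Real.log (3 / w j) + 4 * ρ j * e := by
    intro L hL hΦ j
    have h1 : b L j ≤ 3 := by
      have h2 : b L j ≤ ∑ j, b L j :=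
        Finset.single_le_sum (fun i _ => (hb0 L i).le) (Finset.mem_univ j)
      have h3 : 0 ≤ (∑ s, a L s) / Fintype.card S :=
        div_nonneg (Finset.sum_nonneg fun s _ => ha0 L s) hS.le
      dsimp only [Φ] at hΦ
      linarith
    have h2 : Real.exp (L.countP (fun f => decide (f ∈ E j)) - 4 * ρ j * L.length) ≤ 3 / w j := by
      rw [le_div_iff₀ (hw j), sub_eq_add_neg, Real.exp_add, mul_comm]
      exact h1
    have h3 := (Real.le_log_iff_exp_le (div_pos three_pos (hw j))).2 h2
    have h4 : 4 * ρ j * L.length ≤ 4 * ρ j * e := by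
      have := hρ j
      gcongr
    linarith
  have key : ∀ t ≤ e, ∃ L : List Ω, L.length = t ∧ P L ∧ Φ L ≤ 3 := by
    intro t
    induction t with
    | zero =>
      intro _
      refine ⟨[], rfl, hnil, ?_⟩
      have : (∑ s, a [] s) / (Fintype.card S : ℝ) = 1 := by
        simp [a]
      have h2 : ∑ j, b [] j = ∑ j, w j := by simp [b]
      dsimp only [Φ]
      linarith
    | succ t ih =>
      intro ht
      obtain ⟨L, hL, hPL, hΦ⟩ := ih (by omega)
      obtain ⟨hAl, hH⟩ := hstep L hPL (hcount L (by omega) hΦ)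
      have hAlpos : (0 : ℝ) < (Al L).card := by linarith
      have hAlne : (Al L).Nonempty := by
        rw [← Finset.card_pos]; exact_mod_cast hAlpos
      have hAlle : ((Al L).card : ℝ) ≤ Fintype.card Ω := by
        exact_mod_cast Finset.card_le_univ _
      have hA : ∀ s, ∑ f ∈ Al L, a (f :: L) s ≤ (Al L).card * a L s := by
        intro s
        by_cases hs : ∀ f ∈ L, f ∉ H s
        · have h1 : ∀ f ∈ Al L, a (f :: L) s =
              if f ∈ H s then 0 else Real.exp (p * (t + 1)) := by
            intro f _
            by_cases hf : f ∈ H s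
            · simp [a, hf]
            · simp only [a, List.mem_cons, forall_eq_or_imp, hf, not_false_eq_true, true_and,
                if_pos hs, if_false, List.length_cons, hL]
              push_cast; rfl
          rw [Finset.sum_congr rfl h1, Finset.sum_ite]
          have h2 : a L s = Real.exp (p * t) := by simp only [a, if_pos hs, hL]
          have h3 := Finset.card_filter_add_card_filter_not (s := Al L) (fun f => f ∈ H s)
          have h4 := hH s hs
          rw [← Finset.filter_mem_eq_inter] at h4
          have h3' : ((Finset.filter (fun f => f ∈ H s) (Al L)).card : ℝ) +
            (Finset.filter (fun f => f ∉ H s) (Al L)).card = (Al L).card := by exact_mod_cast h3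
          simp only [Finset.sum_const, nsmul_eq_mul, mul_zero, zero_add]
          rw [h2, mul_add, mul_one, Real.exp_add]
          have h5 : ((Finset.filter (fun f => f ∉ H s) (Al L)).card : ℝ) ≤
              (Al L).card * Real.exp (-p) := by
            have : p * (Al L).card ≤ p * Fintype.card Ω := by gcongr
            have := Real.one_sub_le_exp_neg p
            nlinarith
          calc _ ≤ (Al L).card * Real.exp (-p) * (Real.exp (p * t) * Real.exp p) := by gcongr
            _ = (Al L).card * Real.exp (p * t) * (Real.exp (-p) * Real.exp p) := by ring
            _ = _ := by rw [← Real.exp_add]; simp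
        · have h1 : ∀ f ∈ Al L, a (f :: L) s = 0 := by
            intro f _
            refine if_neg fun h => hs fun g hg => h g (List.mem_cons_of_mem _ hg)
          rw [Finset.sum_eq_zero h1]
          exact mul_nonneg hAlpos.le (ha0 L s)
      have hB : ∀ j, ∑ f ∈ Al L, b (f :: L) j ≤ (Al L).card * b L j := by
        intro j
        set c : ℝ := ((L.countP (fun f => decide (f ∈ E j)) : ℕ) : ℝ) with hc
        have h1 : ∀ f ∈ Al L, b (f :: L) j = w j * Real.exp c *
            Real.exp (-(4 * ρ j * t)) * Real.exp (-(4 * ρ j)) *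
            (if f ∈ E j then Real.exp 1 else 1) := by
          intro f _
          have h0 : Real.exp (-(4 * ρ j * ((f :: L).length : ℝ))) =
              Real.exp (-(4 * ρ j * t)) * Real.exp (-(4 * ρ j)) := by
            rw [← Real.exp_add, List.length_cons, hL]; push_cast; ring_nf
          have h00 : Real.exp (((f :: L).countP (fun f => decide (f ∈ E j)) : ℕ) : ℝ) =
              Real.exp c * (if f ∈ E j then Real.exp 1 else 1) := by
            by_cases hf : f ∈ E j
            · rw [List.countP_cons_of_pos (by simpa using hf), if_pos hf, ← Real.exp_add]
              push_cast; rfl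
            · rw [List.countP_cons_of_neg (by simpa using hf), if_neg hf, mul_one]
          dsimp only [b]
          rw [h0, h00]; ring
        rw [Finset.sum_congr rfl h1, ← Finset.mul_sum, Finset.sum_ite]
        simp only [Finset.sum_const, nsmul_eq_mul, mul_one]
        have h3 := Finset.card_filter_add_card_filter_not (s := Al L) (fun f => f ∈ E j)
        have h3' : ((Finset.filter (fun f => f ∈ E j) (Al L)).card : ℝ) +
            (Finset.filter (fun f => f ∉ E j) (Al L)).card = (Al L).card := by exact_mod_cast h3
        have h4 : ((Finset.filter (fun f => f ∈ E j) (Al L)).card : ℝ) ≤ (E j).card := by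
          exact_mod_cast Finset.card_le_card (fun x hx => (Finset.mem_filter.1 hx).2)
        have h5 := hE j
        have h6 : Real.exp 1 < 3 := Real.exp_one_lt_three
        have h7 : ((Finset.filter (fun f => f ∈ E j) (Al L)).card : ℝ) * Real.exp 1 +
            (Finset.filter (fun f => f ∉ E j) (Al L)).card ≤
            (Al L).card * Real.exp (4 * ρ j) := by
          have h8 := Real.add_one_le_exp (4 * ρ j)
          have h9 : ρ j * Fintype.card Ω ≤ ρ j * (2 * (Al L).card) := by
            have := hρ j
            gcongr
          have h10 : (0 : ℝ) ≤ (Finset.filter (fun f => f ∈ E j) (Al L)).card := by positivity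
          nlinarith
        have h11 : b L j = w j * Real.exp c * Real.exp (-(4 * ρ j * t)) := by
          dsimp only [b]; rw [hL]; ring
        rw [h11]
        have := hw j
        calc _ ≤ w j * Real.exp c * Real.exp (-(4 * ρ j * t)) * Real.exp (-(4 * ρ j)) *
              ((Al L).card * Real.exp (4 * ρ j)) := by gcongr
          _ = (Al L).card * (w j * Real.exp c * Real.exp (-(4 * ρ j * t))) *
              (Real.exp (-(4 * ρ j)) * Real.exp (4 * ρ j)) := by ring
          _ = _ := by rw [← Real.exp_add]; simp
      have hsum : ∑ f ∈ Al L, Φ (f :: L) ≤ ∑ _f ∈ Al L, Φ L := by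
        rw [Finset.sum_const, nsmul_eq_mul]
        dsimp only [Φ]
        rw [Finset.sum_add_distrib, ← Finset.sum_div, Finset.sum_comm, mul_add, ← mul_div_assoc,
          Finset.mul_sum, Finset.mul_sum, Finset.sum_comm (s := Al L)]
        gcongr with s _ j _
        · exact hA s
        · exact hB j
      obtain ⟨f, hf, hfΦ⟩ := Finset.exists_le_of_sum_le hAlne hsum
      exact ⟨f :: L, by simp [hL], hcons L f hPL hf, hfΦ.trans hΦ⟩
  obtain ⟨L, hL, hPL, hΦ⟩ := key e le_rfl
  refine ⟨L, hL, hPL, fun s => ?_⟩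
  by_contra! hs
  have h1 : a L s = Real.exp (p * e) := by simp only [a, if_pos hs, hL]
  have h2 : a L s ≤ ∑ s, a L s :=
    Finset.single_le_sum (fun i _ => ha0 L i) (Finset.mem_univ s)
  have h3 : 0 ≤ ∑ j, b L j := Finset.sum_nonneg fun j _ => (hb0 L j).le
  have h4 : (∑ s, a L s) / (Fintype.card S : ℝ) ≤ 3 := by
    dsimp only [Φ] at hΦ
    linarith
  rw [div_le_iff₀ hS] at h4
  linarith

/-- If a binary relation holds with density at most `δ` between `D i` and `D j`, then the
coordinates `i ≠ j` of the functions in the box `∏ D l` are related with density at most `δ`. -/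
theorem card_piFinset_filter_le {ι V : Type*} [Fintype ι] [DecidableEq ι] [DecidableEq V]
    (D : ι → Finset V) {i j : ι} (hij : i ≠ j) (R : V → V → Prop) [DecidableRel R]
    (δ : ℝ) (h : (((D i ×ˢ D j).filter fun x => R x.1 x.2).card : ℝ) ≤
      δ * ((D i).card * (D j).card)) :
    (((Fintype.piFinset D).filter fun f => R (f i) (f j)).card : ℝ) ≤
      δ * ∏ l, ((D l).card : ℝ) := by
  set Q := (D i ×ˢ D j).filter fun x => R x.1 x.2 with hQ
  set c : ι → ℕ := fun l => (D l).card with hc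
  set r : ℕ := ∏ l, Function.update (Function.update c i 1) j 1 l with hr
  have hmaps : ∀ f ∈ (Fintype.piFinset D).filter (fun f => R (f i) (f j)), (f i, f j) ∈ Q := by
    intro f hf
    simp only [Finset.mem_filter, Fintype.mem_piFinset] at hf
    simp [hQ, hf.1, hf.2]
  have hfib : ∀ x ∈ Q, (((Fintype.piFinset D).filter (fun f => R (f i) (f j))).filter
      fun f => (f i, f j) = x).card ≤ r := by
    rintro ⟨x, y⟩ -
    have : r = (Fintype.piFinset
        (Function.update (Function.update D i {x}) j {y})).card := by
      rw [Fintype.card_piFinset, hr]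
      refine Finset.prod_congr rfl fun l _ => ?_
      by_cases h1 : l = j
      · subst h1; simp
      · by_cases h2 : l = i
        · subst h2; simp [h1]
        · simp [h1, h2, hc]
    rw [this]
    refine Finset.card_le_card fun f hf => ?_
    simp only [Finset.mem_filter, Fintype.mem_piFinset, Prod.mk.injEq] at hf ⊢
    intro l
    by_cases h1 : l = j
    · subst h1; simp [hf.2.2]
    · by_cases h2 : l = i
      · subst h2; simp [h1, hf.2.1]
      · simpa [h1, h2] using hf.1.1 l
  have hcard := Finset.card_eq_sum_card_fiberwise hmaps
  have h1 : ((Fintype.piFinset D).filter fun f => R (f i) (f j)).card ≤ Q.card * r := by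
    rw [hcard, ← smul_eq_mul]
    exact Finset.sum_le_card_nsmul _ _ _ hfib
  have h2 : c i * (c j * r) = ∏ l, c l := by
    rw [hr, Finset.prod_update_of_mem (Finset.mem_univ j), one_mul,
      Finset.prod_update_of_mem (by simp [hij]), one_mul,
      ← Finset.mul_prod_erase Finset.univ c (Finset.mem_univ j),
      ← Finset.mul_prod_erase (Finset.univ.erase j) c (a := i) (by simp [hij]),
      ← Finset.sdiff_singleton_eq_erase, ← Finset.sdiff_singleton_eq_erase]
    ring
  calc (((Fintype.piFinset D).filter fun f => R (f i) (f j)).card : ℝ)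
      ≤ (Q.card : ℝ) * r := by exact_mod_cast h1
    _ ≤ δ * ((D i).card * (D j).card) * r := by gcongr
    _ = δ * ((c i * (c j * r) : ℕ) : ℝ) := by simp only [hc]; push_cast; ring
    _ = _ := by rw [h2]; push_cast; rfl

/-- Union bound over the pairs of coordinates: at least half of a box avoids a sparse relation. -/
theorem half_prod_le_card_filter {ι V : Type*} [Fintype ι] [DecidableEq ι] [DecidableEq V]
    (D : ι → Finset V) (R : V → V → Prop) [DecidableRel R] (δ : ι → ι → ℝ)
    (hδ : ∀ i j, 0 ≤ δ i j)
    (h : ∀ i j, i ≠ j → (((D i ×ˢ D j).filter fun x => R x.1 x.2).card : ℝ) ≤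
      δ i j * ((D i).card * (D j).card))
    (hsum : ∑ i, ∑ j, δ i j ≤ 1 / 2) :
    (∏ l, ((D l).card : ℝ)) / 2 ≤
      ((Fintype.piFinset D).filter fun f => ∀ i j, i ≠ j → ¬ R (f i) (f j)).card := by
  set good := (Fintype.piFinset D).filter fun f => ∀ i j, i ≠ j → ¬ R (f i) (f j)
  set bad : Finset (ι → V) := Finset.univ.biUnion fun i => Finset.univ.biUnion fun j =>
    if i = j then ∅ else (Fintype.piFinset D).filter fun f => R (f i) (f j) with hbad
  have hsub : Fintype.piFinset D ⊆ good ∪ bad := by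
    intro f hf
    by_cases hg : ∀ i j, i ≠ j → ¬ R (f i) (f j)
    · exact Finset.mem_union_left _ (Finset.mem_filter.2 ⟨hf, hg⟩)
    · push Not at hg
      obtain ⟨i, j, hij, hR⟩ := hg
      refine Finset.mem_union_right _ ?_
      simp only [hbad, Finset.mem_biUnion, Finset.mem_univ, true_and]
      exact ⟨i, j, by rw [if_neg hij]; exact Finset.mem_filter.2 ⟨hf, hR⟩⟩
  have h1 := (Finset.card_le_card hsub).trans (Finset.card_union_le _ _)
  rw [Fintype.card_piFinset] at h1
  have h5 : (0 : ℝ) ≤ ∏ l, ((D l).card : ℝ) := Finset.prod_nonneg fun l _ => Nat.cast_nonneg _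
  have h2 : (bad.card : ℝ) ≤ (∑ i, ∑ j, δ i j) * ∏ l, ((D l).card : ℝ) := by
    have h3 : bad.card ≤ ∑ i, ∑ j, (if i = j then ∅ else
        (Fintype.piFinset D).filter fun f => R (f i) (f j) : Finset (ι → V)).card :=
      Finset.card_biUnion_le.trans (Finset.sum_le_sum fun i _ => Finset.card_biUnion_le)
    rw [Finset.sum_mul]
    refine (Nat.cast_le.2 h3).trans ?_
    push_cast
    refine Finset.sum_le_sum fun i _ => ?_
    rw [Finset.sum_mul]
    refine Finset.sum_le_sum fun j _ => ?_
    split_ifs with hij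
    · rw [Finset.card_empty, Nat.cast_zero]
      exact mul_nonneg (hδ i j) h5
    · exact card_piFinset_filter_le D hij R _ (h i j hij)
  have h4 : (∏ l, ((D l).card : ℝ)) ≤ good.card + bad.card := by exact_mod_cast h1
  nlinarith

/-- A relation with few neighbours per vertex has few pairs in any rectangle. -/
theorem card_filter_product_le_left {V : Type*} [Fintype V] [DecidableEq V] (A B : Finset V)
    (R : V → V → Prop) [DecidableRel R] (d : ℝ)
    (h : ∀ x, ((Finset.univ.filter fun y => R x y).card : ℝ) ≤ d) :
    (((A ×ˢ B).filter fun x => R x.1 x.2).card : ℝ) ≤ d * A.card := by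
  have h1 : ((A ×ˢ B).filter fun x => R x.1 x.2).card ≤
      ∑ x ∈ A, (Finset.univ.filter fun y => R x y).card := by
    rw [← Finset.card_sigma]
    refine Finset.card_le_card_of_injOn (fun x => ⟨x.1, x.2⟩) ?_ ?_
    · rintro ⟨x, y⟩ hx
      simp only [Finset.coe_filter, Finset.mem_product, Set.mem_ofPred_eq] at hx
      simp [hx.1.1, hx.2]
    · rintro ⟨x, y⟩ _ ⟨x', y'⟩ _ hxy
      simpa using hxy
  refine (Nat.cast_le.2 h1).trans ?_
  push_cast
  calc _ ≤ ∑ _x ∈ A, d := Finset.sum_le_sum fun x _ => h x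
    _ = _ := by rw [Finset.sum_const, nsmul_eq_mul, mul_comm]

/-- The analogous bound in terms of the second side, for a symmetric relation. -/
theorem card_filter_product_le_right {V : Type*} [Fintype V] [DecidableEq V] (A B : Finset V)
    (R : V → V → Prop) [DecidableRel R] (hR : ∀ x y, R x y → R y x) (d : ℝ)
    (h : ∀ x, ((Finset.univ.filter fun y => R x y).card : ℝ) ≤ d) :
    (((A ×ˢ B).filter fun x => R x.1 x.2).card : ℝ) ≤ d * B.card := by
  refine le_trans ?_ (card_filter_product_le_left B A R d h)
  norm_cast
  refine Finset.card_le_card_of_injOn Prod.swap ?_ Prod.swap_injective.injOn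
  rintro ⟨x, y⟩ hx
  simp only [Finset.coe_filter, Finset.mem_product, Set.mem_ofPred_eq] at hx
  simp [hx.1.1, hx.1.2, hR _ _ hx.2]

/-- For a relation of small degree, at least half of all functions avoid it. -/
theorem half_le_card_avoiding {q N : ℕ} (hN : 0 < N) (R : Fin N → Fin N → Prop) [DecidableRel R]
    (d : ℝ) (hd0 : 0 ≤ d) (hd : ∀ x, ((Finset.univ.filter fun y => R x y).card : ℝ) ≤ d)
    (hdN : 16 * (q : ℝ) ^ 2 * d ≤ N) :
    (N : ℝ) ^ q ≤ 2 * (Finset.univ.filter fun f : Fin q → Fin N =>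
      ∀ i j, i ≠ j → ¬ R (f i) (f j)).card := by
  have hN' : (0 : ℝ) < N := by exact_mod_cast hN
  have h := half_prod_le_card_filter (fun _ : Fin q => (Finset.univ : Finset (Fin N))) R
    (fun _ _ => d / N) (fun _ _ => by positivity) (fun i j _ => ?_) ?_
  · rw [Fintype.piFinset_univ] at h
    simp only [Finset.card_univ, Fintype.card_fin, Finset.prod_const] at h
    rw [div_le_iff₀' two_pos] at h
    refine h.trans (le_of_eq ?_)
    congr!
  · refine (card_filter_product_le_left _ _ R d hd).trans (le_of_eq ?_)
    simp only [Finset.card_univ, Fintype.card_fin]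
    field_simp
  · simp only [Finset.sum_const, Finset.card_univ, Fintype.card_fin, nsmul_eq_mul]
    rw [← mul_assoc, ← mul_div_assoc, div_le_iff₀ hN']
    nlinarith

/-- If a symmetric relation `R` of small degree is sparse inside `S`, then a positive proportion of
the functions avoiding `R` have at least `k` values in `S`. -/
theorem le_card_avoiding_hitting {q N k m : ℕ} (hm : 0 < m) (hk : 0 < k) (hkq : 2 * k ≤ q)
    (hmN : 2 * q * m ≤ N)
    (R : Fin N → Fin N → Prop) [DecidableRel R] (hrefl : ∀ x, R x x) (hR : ∀ x y, R x y → R y x)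
    (S : Finset (Fin N)) (hS : S.card = m)
    (d u : ℝ) (hd0 : 0 ≤ d) (hd : ∀ x, ((Finset.univ.filter fun y => R x y).card : ℝ) ≤ d)
    (hu : (((S ×ˢ S).filter fun x => R x.1 x.2).card : ℝ) ≤ u)
    (hdN : 16 * (q : ℝ) ^ 2 * d ≤ N) (hum : 8 * (k : ℝ) ^ 2 * u ≤ (m : ℝ) ^ 2) :
    1 / 4 * ((q : ℝ) * m / (2 * k * N)) ^ k * (N : ℝ) ^ q ≤
      ((Finset.univ.filter fun f : Fin q → Fin N => ∀ i j, i ≠ j → ¬ R (f i) (f j)) ∩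
        (Finset.univ.filter fun f => k ≤ (Finset.univ.image f ∩ S).card)).card := by
  have hq : 0 < q := by omega
  have hN : 0 < N := lt_of_lt_of_le (by positivity) hmN
  have hm' : (0 : ℝ) < m := by exact_mod_cast hm
  have hk' : (0 : ℝ) < k := by exact_mod_cast hk
  have hq' : (1 : ℝ) ≤ q := by exact_mod_cast hq
  have hN' : (0 : ℝ) < N := by exact_mod_cast hN
  have hmN' : 2 * (q : ℝ) * m ≤ N := by exact_mod_cast hmN
  have hu0 : 0 ≤ u := le_trans (Nat.cast_nonneg _) hu
  have hSc : (Sᶜ.card : ℝ) = N - m := by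
    have := Finset.card_add_card_compl S
    rw [hS, Fintype.card_fin] at this
    have h : (m : ℝ) + Sᶜ.card = N := by exact_mod_cast this
    linarith
  have hNm : (N : ℝ) / 2 ≤ N - m := by nlinarith
  let D : Finset (Fin q) → Fin q → Finset (Fin N) := fun I l => if l ∈ I then S else Sᶜ
  let G : Finset (Fin q) → Finset (Fin q → Fin N) := fun I =>
    (Fintype.piFinset (D I)).filter fun f => ∀ i j, i ≠ j → ¬ R (f i) (f j)
  have hG : ∀ I ∈ Finset.powersetCard k (Finset.univ : Finset (Fin q)),
      (m : ℝ) ^ k * (N - m) ^ (q - k) / 2 ≤ (G I).card := by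
    intro I hI
    have hIk : I.card = k := (Finset.mem_powersetCard.1 hI).2
    have h := half_prod_le_card_filter (D I) R
      (fun i j => (if i ∈ I then if j ∈ I then u / m ^ 2 else 0 else 0) + 2 * d / N)
      (fun i j => by positivity) (fun i j hij => ?_) ?_
    · convert h using 2
      have : ∀ l, ((D I l).card : ℝ) = if l ∈ I then (m : ℝ) else N - m := by
        intro l
        by_cases hl : l ∈ I <;> simp [D, hl, hS, hSc]
      simp_rw [this]
      rw [Finset.prod_ite, Finset.prod_const, Finset.prod_const,
        Finset.filter_mem_eq_inter, Finset.univ_inter, hIk, Finset.filter_not,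
        Finset.filter_mem_eq_inter, Finset.univ_inter, ← Finset.compl_eq_univ_sdiff,
        Finset.card_compl, hIk, Fintype.card_fin]
      simp only [G]
      congr!
    · have hdN2 : d ≤ 2 * d / N * (N - m) := by
        rw [div_mul_eq_mul_div, le_div_iff₀ hN']
        nlinarith
      by_cases hi : i ∈ I
      · by_cases hj : j ∈ I
        · simp only [D, hi, hj, if_true, hS]
          refine hu.trans ?_
          have h1 : u = u / m ^ 2 * (m * m) := by field_simp
          have h2 : 0 ≤ 2 * d / N * ((m : ℝ) * m) := by positivity
          rw [add_mul]; linarith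
        · refine (card_filter_product_le_left _ _ R d hd).trans ?_
          simp only [D, hi, hj, if_true, if_false, hSc, zero_add]
          calc _ ≤ 2 * d / N * (N - m) * (S.card : ℝ) := by gcongr
            _ = _ := by ring
      · refine (card_filter_product_le_right _ _ R hR d hd).trans ?_
        simp only [D, hi, if_false, hSc, zero_add]
        calc _ ≤ 2 * d / N * (N - m) * ((if j ∈ I then S else Sᶜ).card : ℝ) := by gcongr
          _ = _ := by ring
    · have h1 : ∑ i, ∑ j, ((if i ∈ I then if j ∈ I then u / (m : ℝ) ^ 2 else 0 else 0)
          + 2 * d / N) = k ^ 2 * (u / m ^ 2) + q ^ 2 * (2 * d / N) := by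
        have h2 : ∀ i, ∑ j, ((if i ∈ I then if j ∈ I then u / (m : ℝ) ^ 2 else 0 else 0)
            + 2 * d / N) = (if i ∈ I then k * (u / (m : ℝ) ^ 2) else 0) + q * (2 * d / N) := by
          intro i
          by_cases hi : i ∈ I <;> simp [hi, Finset.sum_add_distrib, hIk]
        simp_rw [h2]
        simp [Finset.sum_add_distrib, hIk]
        ring
      rw [h1]
      have h2 : (k : ℝ) ^ 2 * (u / m ^ 2) ≤ 1 / 8 := by
        rw [← mul_div_assoc, div_le_iff₀ (by positivity)]; linarith
      have h3 : (q : ℝ) ^ 2 * (2 * d / N) ≤ 1 / 8 := by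
        rw [← mul_div_assoc, div_le_iff₀ hN']; linarith
      linarith
  have hdisj : (Finset.powersetCard k (Finset.univ : Finset (Fin q)) : Set
      (Finset (Fin q))).PairwiseDisjoint G := by
    intro I _ I' _ hII'
    rw [Function.onFun, Finset.disjoint_left]
    intro f hf hf'
    apply hII'
    have key : ∀ I, f ∈ G I → ∀ l, l ∈ I ↔ f l ∈ S := by
      intro I hf l
      have := Fintype.mem_piFinset.1 (Finset.mem_filter.1 hf).1 l
      by_cases hl : l ∈ I
      · simpa [D, hl] using this
      · simpa [D, hl] using this
    ext l
    rw [key I hf l, key I' hf' l]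
  have hsub : (Finset.powersetCard k (Finset.univ : Finset (Fin q))).biUnion G ⊆
      (Finset.univ.filter fun f : Fin q → Fin N => ∀ i j, i ≠ j → ¬ R (f i) (f j)) ∩
        (Finset.univ.filter fun f => k ≤ (Finset.univ.image f ∩ S).card) := by
    intro f hf
    obtain ⟨I, hI, hfI⟩ := Finset.mem_biUnion.1 hf
    have hIk : I.card = k := (Finset.mem_powersetCard.1 hI).2
    obtain ⟨hf1, hf2⟩ := Finset.mem_filter.1 hfI
    have hinj : Function.Injective f := by
      intro i j hij
      by_contra hne
      exact hf2 i j hne (hij ▸ hrefl _)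
    simp only [Finset.mem_inter, Finset.mem_filter, Finset.mem_univ, true_and]
    refine ⟨hf2, ?_⟩
    rw [← hIk, ← Finset.card_image_of_injective I hinj]
    refine Finset.card_le_card fun x hx => ?_
    obtain ⟨i, hi, rfl⟩ := Finset.mem_image.1 hx
    have := Fintype.mem_piFinset.1 hf1 i
    simp only [D, hi, if_true] at this
    simp [this]
  have hcard : (q.choose k : ℝ) * ((m : ℝ) ^ k * (N - m) ^ (q - k) / 2) ≤
      ((Finset.powersetCard k (Finset.univ : Finset (Fin q))).biUnion G).card := by
    rw [Finset.card_biUnion hdisj]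
    push_cast
    calc _ = ∑ _I ∈ Finset.powersetCard k (Finset.univ : Finset (Fin q)),
          ((m : ℝ) ^ k * (N - m) ^ (q - k) / 2) := by
          rw [Finset.sum_const, Finset.card_powersetCard, Finset.card_univ, Fintype.card_fin,
            nsmul_eq_mul]
      _ ≤ _ := Finset.sum_le_sum hG
  have hchoose : ((q : ℝ) / (2 * k)) ^ k ≤ q.choose k := by
    refine le_trans ?_ (Nat.pow_le_choose (α := ℝ) k q)
    have h1 : (q : ℝ) / 2 ≤ ((q + 1 - k : ℕ) : ℝ) := by
      rw [Nat.cast_sub (by omega)]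
      have : 2 * (k : ℝ) ≤ q := by exact_mod_cast hkq
      push_cast; linarith
    have h2 : ((k.factorial : ℕ) : ℝ) ≤ (k : ℝ) ^ k := by exact_mod_cast Nat.factorial_le_pow k
    have h3 : (0 : ℝ) < (k.factorial : ℕ) := by exact_mod_cast Nat.factorial_pos k
    rw [← div_div, div_pow]
    gcongr
  have hpow : (N : ℝ) ^ (q - k) / 2 ≤ (N - m) ^ (q - k) := by
    have h1 := one_add_mul_le_pow (a := -((m : ℝ) / N)) (by
      have : (m : ℝ) / N ≤ 1 := by rw [div_le_one hN']; nlinarith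
      linarith) (q - k)
    have h2 : ((q - k : ℕ) : ℝ) * (m / N) ≤ 1 / 2 := by
      have : ((q - k : ℕ) : ℝ) ≤ q := by exact_mod_cast Nat.sub_le q k
      rw [← mul_div_assoc, div_le_iff₀ hN']
      nlinarith
    have h3 : ((N : ℝ) - m) = N * (1 + -(m / N)) := by field_simp; ring
    rw [h3, mul_pow]
    have h4 : (0 : ℝ) < (N : ℝ) ^ (q - k) := by positivity
    nlinarith
  calc 1 / 4 * ((q : ℝ) * m / (2 * k * N)) ^ k * (N : ℝ) ^ q
      = ((q : ℝ) / (2 * k)) ^ k * ((m : ℝ) ^ k * ((N : ℝ) ^ (q - k) / 2) / 2) := by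
        have h1 : (N : ℝ) ^ q = N ^ k * N ^ (q - k) := by
          rw [← pow_add]; congr 1; omega
        rw [h1, div_pow, div_pow, mul_pow, mul_pow (2 * (k : ℝ))]
        field_simp
        ring
    _ ≤ (q.choose k : ℝ) * ((m : ℝ) ^ k * (N - m) ^ (q - k) / 2) := by gcongr
    _ ≤ _ := hcard.trans (by exact_mod_cast Finset.card_le_card hsub)

/-- The number of vertices lying in a common member of `L` with `x`. -/
theorem card_neighbors_le {q N : ℕ} (L : List (Fin q → Fin N)) (x : Fin N) :
    (Finset.univ.filter fun y => ∃ g ∈ L, (∃ i, g i = x) ∧ ∃ j, g j = y).card ≤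
      q * L.countP (fun f => decide (∃ i, f i = x)) := by
  induction L with
  | nil => simp
  | cons g L ih =>
    simp only [List.mem_cons, or_and_right, exists_or, exists_eq_left]
    rw [Finset.filter_or]
    refine (Finset.card_union_le _ _).trans ?_
    rw [List.countP_cons, mul_add, add_comm]
    refine add_le_add ih ?_
    by_cases hg : ∃ i, g i = x
    · simp only [hg, true_and, decide_true, if_true, mul_one]
      calc _ ≤ (Finset.univ.image g).card := by
            refine Finset.card_le_card fun y hy => ?_
            simpa using hy
        _ ≤ _ := Finset.card_image_le.trans (by simp)
    · simp [hg]

/-- The number of ordered pairs of distinct vertices of `S` lying in a common member of `L`, when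
all members of `L` meet `S` in fewer than `k` vertices. -/
theorem card_covered_pairs_le {q N k : ℕ} (L : List (Fin q → Fin N)) (S : Finset (Fin N))
    (hL : ∀ g ∈ L, (Finset.univ.image g ∩ S).card < k) :
    ((S ×ˢ S).filter fun x => x.1 ≠ x.2 ∧
      ∃ g ∈ L, (∃ i, g i = x.1) ∧ ∃ j, g j = x.2).card ≤
      k ^ 2 * L.countP (fun f => decide (∃ i j, i ≠ j ∧ f i ∈ S ∧ f j ∈ S)) := by
  induction L with
  | nil => simp
  | cons g L ih =>
    simp only [List.mem_cons, or_and_right, exists_or, exists_eq_left, and_or_left]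
    rw [Finset.filter_or]
    refine (Finset.card_union_le _ _).trans ?_
    rw [List.countP_cons, mul_add, add_comm]
    refine add_le_add (ih fun g hg => hL g (List.mem_cons_of_mem _ hg)) ?_
    by_cases hg : ∃ i j, i ≠ j ∧ g i ∈ S ∧ g j ∈ S
    · simp only [hg, decide_true, if_true, mul_one]
      calc _ ≤ ((Finset.univ.image g ∩ S) ×ˢ (Finset.univ.image g ∩ S)).card := by
            refine Finset.card_le_card fun y hy => ?_
            simp only [Finset.mem_filter, Finset.mem_product] at hy
            simp only [Finset.mem_product, Finset.mem_inter, Finset.mem_image, Finset.mem_univ,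
              true_and]
            exact ⟨⟨hy.2.2.1, hy.1.1⟩, ⟨hy.2.2.2, hy.1.2⟩⟩
        _ ≤ k ^ 2 := by
            rw [Finset.card_product, sq]
            have := (hL g (by simp)).le
            gcongr
    · rw [Finset.card_eq_zero.2]
      · exact Nat.zero_le _
      · refine Finset.filter_eq_empty_iff.2 ?_
        rintro ⟨x, y⟩ hxy ⟨hne, ⟨i, hi⟩, ⟨j, hj⟩⟩
        rw [Finset.mem_product] at hxy
        refine hg ⟨i, j, ?_, hi ▸ hxy.1, hj ▸ hxy.2⟩
        rintro rfl
        exact hne (hi.symm.trans hj)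

/-- The number of functions taking the value `x`. -/
theorem card_filter_exists_eq_le {q N : ℕ} (hq : 2 ≤ q) (hN : 0 < N) (x : Fin N) :
    ((Finset.univ.filter fun f : Fin q → Fin N => ∃ i, f i = x).card : ℝ) ≤
      (q : ℝ) / N * (N : ℝ) ^ q := by
  have hN' : (0 : ℝ) < N := by exact_mod_cast hN
  have h1 : (Finset.univ.filter fun f : Fin q → Fin N => ∃ i, f i = x) ⊆
      Finset.univ.biUnion fun i => Finset.univ.filter fun f : Fin q → Fin N => f i = x := by
    intro f hf
    simpa using hf
  have h2 : ∀ i : Fin q, ((Finset.univ.filter fun f : Fin q → Fin N => f i = x).card : ℝ) ≤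
      1 / N * (N : ℝ) ^ q := by
    intro i
    obtain ⟨j, hj⟩ : ∃ j : Fin q, j ≠ i := by
      have : Nontrivial (Fin q) := Fin.nontrivial_iff_two_le.2 hq
      exact exists_ne i
    have := card_piFinset_filter_le (fun _ : Fin q => (Finset.univ : Finset (Fin N))) hj.symm
      (fun a _ => a = x) (1 / N) ?_
    · simpa using this
    · have h3 : ((Finset.univ ×ˢ Finset.univ : Finset (Fin N × Fin N)).filter
          fun y => y.1 = x).card ≤ N := by
        calc _ ≤ (({x} : Finset (Fin N)) ×ˢ (Finset.univ : Finset (Fin N))).card := by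
              refine Finset.card_le_card fun y hy => Finset.mem_product.2 ⟨?_, Finset.mem_univ _⟩
              simpa using hy
          _ = N := by simp
      refine (Nat.cast_le.2 h3).trans (le_of_eq ?_)
      simp only [Finset.card_univ, Fintype.card_fin]
      field_simp
  have h4 : ((Finset.univ.filter fun f : Fin q → Fin N => ∃ i, f i = x).card : ℝ) ≤
      ∑ i : Fin q, ((Finset.univ.filter fun f : Fin q → Fin N => f i = x).card : ℝ) := by
    exact_mod_cast (Finset.card_le_card h1).trans Finset.card_biUnion_le
  refine h4.trans ((Finset.sum_le_sum fun i _ => h2 i).trans (le_of_eq ?_))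
  rw [Finset.sum_const, Finset.card_univ, Fintype.card_fin, nsmul_eq_mul]
  ring

/-- The number of functions sending two different arguments to `S`. -/
theorem card_filter_two_mem_le {q N m : ℕ} (hN : 0 < N) (S : Finset (Fin N)) (hS : S.card = m) :
    ((Finset.univ.filter fun f : Fin q → Fin N => ∃ i j, i ≠ j ∧ f i ∈ S ∧ f j ∈ S).card : ℝ) ≤
      ((q : ℝ) * m / N) ^ 2 * (N : ℝ) ^ q := by
  have hN' : (0 : ℝ) < N := by exact_mod_cast hN
  have h1 : (Finset.univ.filter fun f : Fin q → Fin N => ∃ i j, i ≠ j ∧ f i ∈ S ∧ f j ∈ S) ⊆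
      Finset.univ.biUnion fun i => Finset.univ.biUnion fun j =>
        Finset.univ.filter fun f : Fin q → Fin N => i ≠ j ∧ f i ∈ S ∧ f j ∈ S := by
    intro f hf
    simpa using hf
  have h2 : ∀ i j : Fin q, ((Finset.univ.filter fun f : Fin q → Fin N =>
      i ≠ j ∧ f i ∈ S ∧ f j ∈ S).card : ℝ) ≤ ((m : ℝ) / N) ^ 2 * (N : ℝ) ^ q := by
    intro i j
    by_cases hij : i = j
    · simp only [hij, ne_eq, not_true_eq_false, false_and, Finset.filter_false, Finset.card_empty,
        Nat.cast_zero]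
      positivity
    have := card_piFinset_filter_le (fun _ : Fin q => (Finset.univ : Finset (Fin N))) hij
      (fun a b => a ∈ S ∧ b ∈ S) (((m : ℝ) / N) ^ 2) ?_
    · simpa [hij] using this
    · have h3 : ((Finset.univ ×ˢ Finset.univ : Finset (Fin N × Fin N)).filter
          fun y => y.1 ∈ S ∧ y.2 ∈ S).card ≤ m * m := by
        rw [← hS, ← Finset.card_product]
        refine Finset.card_le_card fun y hy => ?_
        simpa using hy
      refine (Nat.cast_le.2 h3).trans (le_of_eq ?_)
      simp only [Finset.card_univ, Fintype.card_fin]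
      push_cast
      field_simp
  have h4 : ((Finset.univ.filter fun f : Fin q → Fin N =>
      ∃ i j, i ≠ j ∧ f i ∈ S ∧ f j ∈ S).card : ℝ) ≤
      ∑ i : Fin q, ∑ j : Fin q, ((Finset.univ.filter fun f : Fin q → Fin N =>
        i ≠ j ∧ f i ∈ S ∧ f j ∈ S).card : ℝ) := by
    exact_mod_cast (Finset.card_le_card h1).trans (Finset.card_biUnion_le.trans
      (Finset.sum_le_sum fun i _ => Finset.card_biUnion_le))
  refine h4.trans ((Finset.sum_le_sum fun i _ => Finset.sum_le_sum fun j _ => h2 i j).trans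
    (le_of_eq ?_))
  simp only [Finset.sum_const, Finset.card_univ, Fintype.card_fin, nsmul_eq_mul]
  ring

/-- A list of injections whose ranges pairwise meet in at most one point yields a `1`-system. -/
theorem isSystem_of_list {q N : ℕ} (hq : 2 ≤ q) (L : List (Fin q → Fin N))
    (hinj : ∀ f ∈ L, Function.Injective f)
    (hL : L.Pairwise fun f g => (Finset.univ.image f ∩ Finset.univ.image g).card ≤ 1) :
    IsSystem 1 q (L.map fun f => Finset.univ.image f).toFinset ∧
      (L.map fun f => Finset.univ.image f).toFinset.card = L.length := by
  have hcard : ∀ f ∈ L, (Finset.univ.image f).card = q := fun f hf => by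
    rw [Finset.card_image_of_injective _ (hinj f hf), Finset.card_univ, Fintype.card_fin]
  refine ⟨⟨?_, ?_⟩, ?_⟩
  · intro A hA
    obtain ⟨f, hf, rfl⟩ := List.mem_map.1 (List.mem_toFinset.1 hA)
    exact hcard f hf
  · intro A hA B hB hAB
    obtain ⟨f, hf, rfl⟩ := List.mem_map.1 (List.mem_toFinset.1 hA)
    obtain ⟨g, hg, rfl⟩ := List.mem_map.1 (List.mem_toFinset.1 hB)
    have hsymm : Std.Symm fun f g : Fin q → Fin N =>
        (Finset.univ.image f ∩ Finset.univ.image g).card ≤ 1 :=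
      ⟨fun f g h => by rwa [Finset.inter_comm]⟩
    exact hL.forall hf hg fun h => hAB (by rw [h])
  · rw [List.toFinset_card_of_nodup, List.length_map]
    rw [List.Nodup, List.pairwise_map]
    refine hL.imp_of_mem fun {f g} hf _ h heq => ?_
    rw [← heq, Finset.inter_self, hcard f hf] at h
    omega

/-- Under three numerical conditions there is a `1`-system of `e` cliques of size `q` on `N`
vertices such that every set of `m` vertices contains `k` vertices of some clique. -/
theorem exists_system_hitting {q N k m e : ℕ} (hk : 0 < k) (hkq : 2 * k ≤ q) (hm : 0 < m)
    (hmN : 2 * q * m ≤ N)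
    (h1 : 16 * (q : ℝ) ^ 2 * (1 + q * (Real.log (3 * N) + 4 * (q / N) * e)) ≤ N)
    (h2 : 8 * (k : ℝ) ^ 2 * (m + k ^ 2 * (m * Real.log (3 * N) + 4 * (q * m / N) ^ 2 * e)) ≤
      (m : ℝ) ^ 2)
    (h3 : m * Real.log (3 * N) < 1 / 4 * ((q : ℝ) * m / (2 * k * N)) ^ k * e) :
    ∃ 𝒜 : Finset (Finset (Fin N)), IsSystem 1 q 𝒜 ∧ 𝒜.card = e ∧
      ∀ S : Finset (Fin N), S.card = m → ∃ A ∈ 𝒜, k ≤ (A ∩ S).card := by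
  classical
  have hq : 2 ≤ q := by omega
  have hN : 0 < N := lt_of_lt_of_le (by positivity) hmN
  have hN' : (0 : ℝ) < N := by exact_mod_cast hN
  have hm1 : (1 : ℝ) ≤ m := by exact_mod_cast hm
  have hmN1 : m ≤ N := by nlinarith
  have : NeZero N := ⟨hN.ne'⟩
  let T := {S : Finset (Fin N) // S.card = m}
  have hTcard : Fintype.card T = N.choose m := by
    simp [T, Fintype.card_finset_len]
  have hTpos : 0 < Fintype.card T := by rw [hTcard]; exact Nat.choose_pos hmN1
  have hTpos' : (0 : ℝ) < Fintype.card T := by exact_mod_cast hTpos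
  have : Nonempty T := Fintype.card_pos_iff.1 hTpos
  have hlog : Real.log (3 * Fintype.card T) ≤ m * Real.log (3 * N) := by
    rw [← Real.log_pow]
    refine Real.log_le_log (by positivity) ?_
    rw [mul_pow]
    have h4 : (Fintype.card T : ℝ) ≤ (N : ℝ) ^ m := by
      rw [hTcard]; exact_mod_cast Nat.choose_le_pow N m
    have h5 : (3 : ℝ) ≤ 3 ^ m := by
      calc (3 : ℝ) = 3 ^ 1 := by norm_num
        _ ≤ 3 ^ m := pow_le_pow_right₀ (by norm_num) hm
    gcongr
  let E : T ⊕ Fin N → Finset (Fin q → Fin N) := Sum.elim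
    (fun S => Finset.univ.filter fun f => ∃ i j, i ≠ j ∧ f i ∈ S.1 ∧ f j ∈ S.1)
    (fun x => Finset.univ.filter fun f => ∃ i, f i = x)
  let w : T ⊕ Fin N → ℝ := Sum.elim (fun _ => 1 / Fintype.card T) (fun _ => 1 / N)
  let ρ : T ⊕ Fin N → ℝ := Sum.elim (fun _ => (q * m / N) ^ 2) (fun _ => q / N)
  let H : T → Finset (Fin q → Fin N) := fun S =>
    Finset.univ.filter fun f => k ≤ (Finset.univ.image f ∩ S.1).card
  let R : List (Fin q → Fin N) → Fin N → Fin N → Prop := fun L x y =>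
    x = y ∨ ∃ g ∈ L, (∃ i, g i = x) ∧ ∃ j, g j = y
  let Al : List (Fin q → Fin N) → Finset (Fin q → Fin N) := fun L =>
    Finset.univ.filter fun f => ∀ i j, i ≠ j → ¬ R L (f i) (f j)
  let P : List (Fin q → Fin N) → Prop := fun L => (∀ f ∈ L, Function.Injective f) ∧
    L.Pairwise fun f g => (Finset.univ.image f ∩ Finset.univ.image g).card ≤ 1
  have hcardΩ : (Fintype.card (Fin q → Fin N) : ℝ) = (N : ℝ) ^ q := by simp
  have main : ∃ L : List (Fin q → Fin N), L.length = e ∧ P L ∧ ∀ s, ∃ f ∈ L, f ∈ H s := by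
    refine exists_list_hitting E H w ρ (1 / 4 * ((q : ℝ) * m / (2 * k * N)) ^ k) e Al P
      ⟨by simp, by simp⟩ ?_ ?_ ?_ (by positivity) ?_ ?_ ?_
    · rintro L f ⟨hL1, hL2⟩ hf
      have hf' := (Finset.mem_filter.1 hf).2
      refine ⟨?_, ?_⟩
      · intro g hg
        rcases List.mem_cons.1 hg with rfl | hg
        · intro i j hij
          by_contra hne
          exact hf' i j hne (Or.inl hij)
        · exact hL1 g hg
      · refine List.pairwise_cons.2 ⟨fun g hg => ?_, hL2⟩
        refine Finset.card_le_one.2 fun a ha b hb => ?_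
        simp only [Finset.mem_inter, Finset.mem_image, Finset.mem_univ, true_and] at ha hb
        obtain ⟨⟨i, rfl⟩, hi⟩ := ha
        obtain ⟨⟨j, rfl⟩, hj⟩ := hb
        by_contra hne
        exact hf' i j (fun h => hne (by rw [h])) (Or.inr ⟨g, hg, hi, hj⟩)
    · rintro (S | x)
      · exact div_pos one_pos hTpos'
      · exact div_pos one_pos hN'
    · rw [Fintype.sum_sum_type]
      simp only [w, Sum.elim_inl, Sum.elim_inr, Finset.sum_const, Finset.card_univ, nsmul_eq_mul,
        Fintype.card_fin]
      rw [mul_one_div_cancel hTpos'.ne', mul_one_div_cancel hN'.ne']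
      norm_num
    · rw [hcardΩ]
      rintro (S | x)
      · exact card_filter_two_mem_le hN S.1 S.2
      · exact card_filter_exists_eq_le hq hN x
    · rw [← Real.log_lt_iff_lt_exp (by positivity)]
      exact hlog.trans_lt h3
    · rintro L ⟨hL1, -⟩ hcount
      rw [hcardΩ]
      set d : ℝ := 1 + q * (Real.log (3 * N) + 4 * (q / N) * e) with hd
      set u : ℝ := m + k ^ 2 * (m * Real.log (3 * N) + 4 * (q * m / N) ^ 2 * e) with hu
      have hdeg : ∀ x, ((Finset.univ.filter fun y => R L x y).card : ℝ) ≤ d := by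
        intro x
        have h4 := hcount (Sum.inr x)
        simp only [E, w, ρ, Sum.elim_inr, Finset.mem_filter, Finset.mem_univ, true_and,
          div_div_eq_mul_div, div_one] at h4
        have h5 := card_neighbors_le L x
        have h6 : (Finset.univ.filter fun y => R L x y).card ≤
            1 + q * L.countP (fun f => decide (∃ i, f i = x)) := by
          simp only [R]
          rw [Finset.filter_or]
          refine (Finset.card_union_le _ _).trans (add_le_add ?_ (le_of_eq_of_le ?_ h5))
          · rw [Finset.filter_eq, if_pos (Finset.mem_univ x), Finset.card_singleton]
          · congr!
        refine (Nat.cast_le.2 h6).trans ?_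
        push_cast
        rw [hd]
        gcongr
      have hd0 : 0 ≤ d := (Nat.cast_nonneg _).trans (hdeg 0)
      have hRrefl : ∀ x, R L x x := fun x => Or.inl rfl
      have hRsymm : ∀ x y, R L x y → R L y x := by
        rintro x y (rfl | ⟨g, hg, hx, hy⟩)
        · exact Or.inl rfl
        · exact Or.inr ⟨g, hg, hy, hx⟩
      refine ⟨?_, fun S hSL => ?_⟩
      · refine (half_le_card_avoiding hN (R L) d hd0 hdeg h1).trans (le_of_eq ?_)
        simp only [Al]
      · have hpairs : (((S.1 ×ˢ S.1).filter fun x => R L x.1 x.2).card : ℝ) ≤ u := by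
          have h4 := hcount (Sum.inl S)
          simp only [E, w, ρ, Sum.elim_inl, Finset.mem_filter, Finset.mem_univ, true_and,
            div_div_eq_mul_div, div_one] at h4
          have h5 := card_covered_pairs_le (k := k) L S.1 (fun g hg => by
            have := hSL g hg
            simpa [H] using this)
          have h6 : ((S.1 ×ˢ S.1).filter fun x => R L x.1 x.2).card ≤
              m + k ^ 2 * L.countP (fun f => decide (∃ i j, i ≠ j ∧ f i ∈ S.1 ∧ f j ∈ S.1)) := by
            refine le_trans (le_trans (Finset.card_le_card (t := S.1.diag ∪
              (S.1 ×ˢ S.1).filter fun x => x.1 ≠ x.2 ∧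
                ∃ g ∈ L, (∃ i, g i = x.1) ∧ ∃ j, g j = x.2) ?_) (Finset.card_union_le _ _))
              (add_le_add ?_ (le_of_eq_of_le ?_ h5))
            · rintro ⟨x, y⟩ hxy
              simp only [Finset.mem_filter, Finset.mem_product, R] at hxy
              by_cases hxy' : x = y
              · exact Finset.mem_union_left _ (Finset.mem_diag.2 ⟨hxy.1.1, hxy'⟩)
              · refine Finset.mem_union_right _ (Finset.mem_filter.2
                  ⟨Finset.mem_product.2 hxy.1, hxy', ?_⟩)
                exact hxy.2.resolve_left hxy'
            · rw [Finset.diag_card, S.2]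
            · congr!
          refine (Nat.cast_le.2 h6).trans ?_
          push_cast
          rw [hu]
          gcongr
          refine le_trans (le_of_eq_of_le ?_ h4) ?_
          · congr!
          · gcongr
        refine (le_card_avoiding_hitting hm hk hkq hmN (R L) hRrefl hRsymm S.1 S.2 d u hd0 hdeg
          hpairs h1 h2).trans (le_of_eq ?_)
        simp only [Al, H]
  obtain ⟨L, hLe, hLP, hLH⟩ := main
  obtain ⟨hsys, hcard⟩ := isSystem_of_list hq L hLP.1 hLP.2
  refine ⟨_, hsys, hcard.trans hLe, fun S hS => ?_⟩
  obtain ⟨f, hf, hfH⟩ := hLH ⟨S, hS⟩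
  refine ⟨Finset.univ.image f, List.mem_toFinset.2 (List.mem_map.2 ⟨f, hf, rfl⟩), ?_⟩
  exact (Finset.mem_filter.1 hfH).2

set_option maxHeartbeats 2000000 in
/-- The numerical conditions of `exists_system_hitting` hold for `N = q ^ 3 * s`, `s ≈ √e`, and `m`
the average size of a colour class among `B` classes, provided `q` is large. -/
theorem numerical_conditions {k q e s : ℕ} (hk : 3 ≤ k) (hq : 100 * k ≤ q) (hs4 : q ^ 4 ≤ s)
    (hes : e < s ^ 2) (hse : s ^ 2 ≤ 4 * e) (c B : ℝ) (hc0 : 0 < c)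
    (hc : c * (16 * (2 * k) ^ k) = 1) (hB0 : 0 < B)
    (hB : B ^ (k - 1) * Real.log e = c ^ (k - 1) * √e * q ^ (k - 3))
    (hr : (200 * (k : ℝ) ^ 4 + 4 * (4 / c) ^ (k - 1)) * Real.log s ≤ √s) :
    ∃ N m : ℕ, 0 < N ∧ 0 < m ∧ m = ⌈(N : ℝ) / B⌉₊ ∧ 2 * q * m ≤ N ∧
      16 * (q : ℝ) ^ 2 * (1 + q * (Real.log (3 * N) + 4 * (q / N) * e)) ≤ N ∧
      8 * (k : ℝ) ^ 2 * (m + k ^ 2 * (m * Real.log (3 * N) + 4 * (q * m / N) ^ 2 * e)) ≤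
        (m : ℝ) ^ 2 ∧
      m * Real.log (3 * N) < 1 / 4 * ((q : ℝ) * m / (2 * k * N)) ^ k * e := by
  have hk3 : (3 : ℝ) ≤ k := by exact_mod_cast hk
  have hqk : 100 * (k : ℝ) ≤ q := by exact_mod_cast hq
  have hq300 : (300 : ℝ) ≤ q := by linarith
  have hq0 : (0 : ℝ) < q := by linarith
  have hs4' : (q : ℝ) ^ 4 ≤ s := by exact_mod_cast hs4
  have hes' : (e : ℝ) ≤ (s : ℝ) ^ 2 := by exact_mod_cast hes.le
  have hse' : (s : ℝ) ^ 2 ≤ 4 * e := by exact_mod_cast hse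
  have hsq : (q : ℝ) ≤ s := by
    refine le_trans ?_ hs4'
    exact le_self_pow₀ (by linarith) (by norm_num)
  have hs0 : (0 : ℝ) < s := by linarith
  have he0 : (0 : ℝ) < e := by nlinarith
  have hc1 : c ≤ 1 := by
    have h1 : (1 : ℝ) ≤ (2 * k) ^ k := one_le_pow₀ (by linarith)
    nlinarith
  set ℓ := Real.log s with hℓ
  set r := √(s : ℝ) with hr'
  have hr0 : 0 < r := Real.sqrt_pos.2 hs0
  have hrs : r ^ 2 = s := Real.sq_sqrt hs0.le
  have hqr : (q : ℝ) ^ 2 ≤ r := by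
    refine Real.le_sqrt_of_sq_le ?_
    rw [← pow_mul]; exact hs4'
  have hℓ1 : 1 ≤ ℓ := by
    rw [hℓ, Real.le_log_iff_exp_le hs0]
    have := Real.exp_one_lt_three
    linarith
  have hloge_le : Real.log e ≤ 2 * ℓ := by
    have := Real.log_le_log he0 hes'
    rwa [Real.log_pow] at this
  have hle_loge : ℓ ≤ Real.log e := by
    refine Real.log_le_log hs0 ?_
    nlinarith
  have hloge0 : 0 < Real.log e := by linarith
  have hsqrt_le : √(e : ℝ) ≤ s := (Real.sqrt_le_left hs0.le).2 hes'
  have hle_sqrt : (s : ℝ) / 2 ≤ √e := by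
    refine Real.le_sqrt_of_sq_le ?_
    rw [div_pow]; linarith
  have hsqrt0 : 0 < √(e : ℝ) := Real.sqrt_pos.2 he0
  have hk40 : 0 ≤ (k : ℝ) ^ 4 := by positivity
  have hcc0 : 0 ≤ (4 / c) ^ (k - 1) := by positivity
  have hr1 : 200 * (k : ℝ) ^ 4 * ℓ ≤ r := by nlinarith
  have hr2 : 4 * (4 / c) ^ (k - 1) * ℓ ≤ r := by nlinarith
  have hk1 : k - 1 = (k - 3) + 2 := by omega
  have hqk3 : (0 : ℝ) < (q : ℝ) ^ (k - 3) := by positivity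
  have hBhi : B ≤ q * r := by
    refine le_of_pow_le_pow_left₀ (n := k - 1) (by omega) (by positivity) ?_
    have h1 : (q : ℝ) ^ (k - 3) * r ^ 2 ≤ (q * r) ^ (k - 1) := by
      rw [mul_pow]
      have hr1' : 1 ≤ r := by nlinarith
      have h2 : (q : ℝ) ^ (k - 3) ≤ q ^ (k - 1) := pow_le_pow_right₀ (by linarith) (by omega)
      have h3 : r ^ 2 ≤ r ^ (k - 1) := pow_le_pow_right₀ hr1' (by omega)
      gcongr
    refine le_trans ?_ h1
    have h2 : c ^ (k - 1) ≤ 1 := pow_le_one₀ hc0.le hc1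
    have h3 : B ^ (k - 1) ≤ B ^ (k - 1) * Real.log e :=
      le_mul_of_one_le_right (by positivity) (by linarith)
    calc B ^ (k - 1) ≤ c ^ (k - 1) * √e * q ^ (k - 3) := h3.trans hB.le
      _ ≤ 1 * s * q ^ (k - 3) := by gcongr
      _ = _ := by rw [hrs]; ring
  have hBlo : 4 * (q : ℝ) ≤ B := by
    refine le_of_pow_le_pow_left₀ (n := k - 1) (by omega) hB0.le ?_
    refine le_of_mul_le_mul_right ?_ hloge0
    rw [hB]
    have h1 : (4 * (q : ℝ)) ^ (k - 1) = c ^ (k - 1) * (4 / c) ^ (k - 1) * (q ^ (k - 3) * q ^ 2) := by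
      rw [← mul_pow, ← pow_add, ← hk1, ← mul_pow]
      congr 1
      field_simp
    rw [h1]
    have h2 : (4 / c) ^ (k - 1) * (q : ℝ) ^ 2 * Real.log e ≤ √e := by
      calc (4 / c) ^ (k - 1) * (q : ℝ) ^ 2 * Real.log e
          ≤ (4 / c) ^ (k - 1) * r * (2 * ℓ) := by gcongr
        _ = 4 * (4 / c) ^ (k - 1) * ℓ * r / 2 := by ring
        _ ≤ r * r / 2 := by gcongr
        _ = s / 2 := by rw [← hrs]; ring
        _ ≤ _ := hle_sqrt
    calc _ = c ^ (k - 1) * ((4 / c) ^ (k - 1) * (q : ℝ) ^ 2 * Real.log e) * q ^ (k - 3) := by ring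
      _ ≤ _ := by gcongr
  have hN : ((q ^ 3 * s : ℕ) : ℝ) = (q : ℝ) ^ 3 * s := by push_cast; rfl
  have hN0 : (0 : ℝ) < (q : ℝ) ^ 3 * s := by positivity
  refine ⟨q ^ 3 * s, ⌈((q ^ 3 * s : ℕ) : ℝ) / B⌉₊, by exact_mod_cast hN0,
    Nat.ceil_pos.2 (by rw [hN]; positivity), rfl, ?_⟩
  have hm_lo := Nat.le_ceil (((q ^ 3 * s : ℕ) : ℝ) / B)
  have hm_hi := (Nat.ceil_lt_add_one (a := ((q ^ 3 * s : ℕ) : ℝ) / B) (by positivity)).le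
  set m := ⌈((q ^ 3 * s : ℕ) : ℝ) / B⌉₊ with hm
  rw [hN] at hm_lo hm_hi
  have hmr : r ≤ m := by
    refine le_trans ?_ hm_lo
    rw [le_div_iff₀ hB0]
    calc r * B ≤ r * (q * r) := by gcongr
      _ = q * r ^ 2 := by ring
      _ ≤ q ^ 3 * r ^ 2 := by
        gcongr
        exact le_self_pow₀ (by linarith) (by norm_num)
      _ = _ := by rw [hrs]
  have hm0 : (0 : ℝ) < m := hr0.trans_le hmr
  have hΛ : Real.log (3 * ((q ^ 3 * s : ℕ) : ℝ)) ≤ 2 * ℓ := by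
    rw [hN, hℓ]
    have h1 : Real.log ((s : ℝ) ^ 2) = 2 * Real.log s := by rw [Real.log_pow]; norm_num
    rw [← h1]
    refine Real.log_le_log (by positivity) ?_
    have h2 : 3 * (q : ℝ) ^ 3 ≤ q ^ 4 := by
      have : (0 : ℝ) < (q : ℝ) ^ 3 := by positivity
      nlinarith
    nlinarith
  have hsl : 200 * ℓ ≤ s := by
    have h1 : (1 : ℝ) ≤ (k : ℝ) ^ 4 := one_le_pow₀ (by linarith)
    have h2 : r ≤ s := by rw [← hrs]; nlinarith
    nlinarith
  rw [hN]
  refine ⟨?_, ?_, ?_, ?_⟩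
  · have h1 : 2 * (q : ℝ) * m ≤ q ^ 3 * s := by
      have h2 : (q : ℝ) ^ 3 * s / B ≤ q ^ 3 * s / (4 * q) := by gcongr
      have h3 : (q : ℝ) ^ 3 * s / (4 * q) = q ^ 2 * s / 4 := by field_simp
      have h4 : (q : ℝ) * q ≤ q ^ 2 * s := by nlinarith
      have h5 : 4 * (q : ℝ) ≤ q ^ 3 * s := by nlinarith
      nlinarith
    exact_mod_cast h1
  · rw [hN] at hΛ
    have h1 : (q : ℝ) / (q ^ 3 * s) * e ≤ s / q ^ 2 := by
      calc (q : ℝ) / (q ^ 3 * s) * e ≤ (q : ℝ) / (q ^ 3 * s) * s ^ 2 := by gcongr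
        _ = _ := by field_simp
    calc _ = 16 * (q : ℝ) ^ 2 * (1 + q * (Real.log (3 * (q ^ 3 * s)) +
          4 * (q / (q ^ 3 * s) * e))) := by ring
      _ ≤ 16 * (q : ℝ) ^ 2 * (1 + q * (2 * ℓ + 4 * (s / q ^ 2))) := by gcongr
      _ = 16 * (q : ℝ) ^ 2 + 32 * q ^ 3 * ℓ + 64 * q * s := by field_simp; ring
      _ ≤ (q : ℝ) ^ 3 * s := by
        have h2 : 32 * (q : ℝ) ^ 3 * ℓ ≤ q ^ 3 * s / 4 := by
          have : (0 : ℝ) < (q : ℝ) ^ 3 := by positivity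
          nlinarith
        have h3 : 64 * (q : ℝ) * s ≤ q ^ 3 * s / 4 := by
          have : (0 : ℝ) < q * s := by positivity
          have : (256 : ℝ) ≤ q ^ 2 := by nlinarith
          nlinarith
        have h4 : 16 * (q : ℝ) ^ 2 ≤ q ^ 3 * s / 4 := by
          have h5 : (0 : ℝ) < (q : ℝ) ^ 2 := by positivity
          have : (64 : ℝ) ≤ q * s := by nlinarith
          nlinarith
        linarith
  · rw [hN] at hΛ
    have h1 : ((q : ℝ) * m / (q ^ 3 * s)) ^ 2 * e ≤ m ^ 2 / q ^ 4 := by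
      calc _ ≤ ((q : ℝ) * m / (q ^ 3 * s)) ^ 2 * s ^ 2 := by gcongr
        _ = _ := by field_simp
    have hkq : 64 * (k : ℝ) ^ 4 ≤ q ^ 4 := by
      calc 64 * (k : ℝ) ^ 4 ≤ 100 ^ 4 * (k : ℝ) ^ 4 := by gcongr; norm_num
        _ = (100 * (k : ℝ)) ^ 4 := by ring
        _ ≤ _ := by gcongr
    calc _ = 8 * (k : ℝ) ^ 2 * (m + k ^ 2 * (m * Real.log (3 * (q ^ 3 * s)) +
          4 * ((q * m / (q ^ 3 * s)) ^ 2 * e))) := by ring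
      _ ≤ 8 * (k : ℝ) ^ 2 * (m + k ^ 2 * (m * (2 * ℓ) + 4 * (m ^ 2 / q ^ 4))) := by gcongr
      _ = 8 * (k : ℝ) ^ 2 * m + 16 * k ^ 4 * ℓ * m + 32 * k ^ 4 / q ^ 4 * m ^ 2 := by ring
      _ ≤ (m : ℝ) ^ 2 / 4 + m ^ 2 / 4 + 1 / 2 * m ^ 2 := by
        have h2 : (k : ℝ) ^ 2 ≤ k ^ 4 * ℓ := by
          have : (k : ℝ) ^ 2 ≤ k ^ 4 := pow_le_pow_right₀ (by linarith) (by norm_num)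
          nlinarith
        have h3 : 200 * (k : ℝ) ^ 4 * ℓ ≤ m := hr1.trans hmr
        have h4 : 32 * (k : ℝ) ^ 4 / q ^ 4 ≤ 1 / 2 := by
          rw [div_le_iff₀ (by positivity)]; linarith
        have h5 : 8 * (k : ℝ) ^ 2 * m ≤ m ^ 2 / 4 := by nlinarith
        have h6 : 16 * (k : ℝ) ^ 4 * ℓ * m ≤ m ^ 2 / 4 := by nlinarith
        gcongr
      _ = _ := by ring
  · rw [hN] at hΛ
    have hMB : 1 / B ≤ m / (q ^ 3 * s) := by
      rw [div_le_div_iff₀ hB0 hN0]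
      rw [div_le_iff₀ hB0] at hm_lo
      linarith
    have hBpow : B ^ (k - 1) = c ^ (k - 1) * √e * q ^ (k - 3) / Real.log e := by
      rw [eq_div_iff hloge0.ne', hB]
    have h1 : ((q : ℝ) * m / (2 * k * (q ^ 3 * s))) ^ k =
        (q / (2 * k)) ^ k * ((m / (q ^ 3 * s)) * (m / (q ^ 3 * s)) ^ (k - 1)) := by
      rw [← pow_succ', Nat.sub_add_cancel (by omega), ← mul_pow]
      congr 1
      field_simp
    have h2 : (1 / B) ^ (k - 1) ≤ (m / ((q : ℝ) ^ 3 * s)) ^ (k - 1) := by gcongr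
    have h3 : 1 / 4 * ((q / (2 * k)) ^ k * ((m / ((q : ℝ) ^ 3 * s)) * (1 / B) ^ (k - 1))) * e =
        m * (1 / 4 * Real.log e * √e / s / (c ^ (k - 1) * (2 * k) ^ k)) := by
      rw [one_div_pow, hBpow, div_pow]
      have h4 : (q : ℝ) ^ k = q ^ (k - 3) * q ^ 3 := by
        rw [← pow_add, Nat.sub_add_cancel hk]
      have h5 : (e : ℝ) = √e * √e := (Real.mul_self_sqrt he0.le).symm
      rw [h4]
      generalize Real.log (e : ℝ) = x at *
      nth_rewrite 2 [h5]
      field_simp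
    rw [h1]
    refine lt_of_lt_of_le ?_ (show 1 / 4 * ((q / (2 * k)) ^ k *
      ((m / ((q : ℝ) ^ 3 * s)) * (1 / B) ^ (k - 1))) * e ≤ _ by gcongr)
    rw [h3]
    refine mul_lt_mul_of_pos_left (hΛ.trans_lt ?_) hm0
    rw [lt_div_iff₀ (by positivity)]
    have h6 : c ^ (k - 1) ≤ c ^ 2 := pow_le_pow_of_le_one hc0.le hc1 (by omega)
    have h7 : c < 1 := by
      have h1 : (1 : ℝ) ≤ (2 * k) ^ k := one_le_pow₀ (by linarith)
      nlinarith
    have h8 : c ^ (k - 1) * (2 * k) ^ k < 1 / 16 := by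
      have h9 : (0 : ℝ) < (2 * k) ^ k := by positivity
      calc c ^ (k - 1) * (2 * k) ^ k ≤ c ^ 2 * (2 * k) ^ k := by gcongr
        _ = c * (c * (16 * (2 * k) ^ k)) / 16 := by ring
        _ < 1 / 16 := by rw [hc]; linarith
    calc 2 * ℓ * (c ^ (k - 1) * (2 * k) ^ k) < 2 * ℓ * (1 / 16) := by gcongr
      _ = 1 / 4 * ℓ * (1 / 2) := by ring
      _ ≤ 1 / 4 * Real.log e * (√e / s) := by
        have : (1 : ℝ) / 2 ≤ √e / s := by rw [le_div_iff₀ hs0]; linarith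
        gcongr
      _ = _ := by ring

/-- If every `m`-set of vertices contains `k` vertices of a clique, then a proper colouring with
`n` colours needs `n ≥ B` whenever `m` is the rounded-up average class size for `B` colours. -/
theorem le_of_sysColorable {N m k n : ℕ} {𝒜 : Finset (Finset (Fin N))} {B : ℝ} (hN : 0 < N)
    (hm : m = ⌈(N : ℝ) / B⌉₊)
    (h𝒜 : ∀ S : Finset (Fin N), S.card = m → ∃ A ∈ 𝒜, k ≤ (A ∩ S).card)
    (hcol : SysColorable k n 𝒜) : B ≤ n := by
  classical
  obtain ⟨χ, hχ⟩ := hcol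
  by_contra! hlt
  have hn : 0 < n := (Nat.zero_le _).trans_lt (χ ⟨0, hN⟩).2
  have hn' : (0 : ℝ) < n := by exact_mod_cast hn
  have : Nonempty (Fin n) := ⟨⟨0, hn⟩⟩
  obtain ⟨c, hc⟩ := Fintype.exists_le_card_fiber_of_nsmul_le_card χ (b := (N : ℝ) / n) (by
    rw [Fintype.card_fin, Fintype.card_fin, nsmul_eq_mul, mul_div_cancel₀ _ hn'.ne'])
  have hmc : m ≤ (Finset.univ.filter fun x => χ x = c).card := by
    rw [hm, Nat.ceil_le]
    refine le_trans ?_ hc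
    gcongr
  obtain ⟨S, hS, hSm⟩ := Finset.exists_subset_card_eq hmc
  obtain ⟨A, hA, hAS⟩ := h𝒜 S hSm
  obtain ⟨T, hT, hTk⟩ := Finset.exists_subset_card_eq hAS
  obtain ⟨u, hu, w, hw, huw⟩ := hχ A hA T (hT.trans Finset.inter_subset_left) hTk
  have hmono : ∀ x ∈ T, χ x = c := fun x hx =>
    (Finset.mem_filter.1 (hS (Finset.mem_inter.1 (hT hx)).2)).2
  exact huw ((hmono u hu).trans (hmono w hw).symm)

/-- The `(k - 1)`-st power of the lower bound on the chromatic number. -/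
theorem lower_bound_pow {k q e : ℕ} (hk : 3 ≤ k) (hq : 0 < q) (he : 1 < e) (c : ℝ) :
    (c * (e : ℝ) ^ ((1 : ℝ) / (2 * (k : ℝ) - 2)) * (q : ℝ) ^ (1 - 2 / ((k : ℝ) - 1)) *
      Real.log e ^ (-(1 : ℝ) / ((k : ℝ) - 1))) ^ (k - 1) * Real.log e =
      c ^ (k - 1) * √e * q ^ (k - 3) := by
  have hk3 : (3 : ℝ) ≤ k := by exact_mod_cast hk
  have hk1 : (k : ℝ) - 1 ≠ 0 := by linarith
  have hlog : 0 < Real.log e := Real.log_pos (by exact_mod_cast he)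
  have hcast1 : ((k - 1 : ℕ) : ℝ) = k - 1 := by rw [Nat.cast_sub (by omega), Nat.cast_one]
  have hcast3 : ((k - 3 : ℕ) : ℝ) = k - 3 := by rw [Nat.cast_sub hk]; norm_num
  have h1 : ((e : ℝ) ^ ((1 : ℝ) / (2 * (k : ℝ) - 2))) ^ (k - 1) = √e := by
    rw [← Real.rpow_natCast, ← Real.rpow_mul (Nat.cast_nonneg e), hcast1, Real.sqrt_eq_rpow]
    congr 1
    rw [show 2 * (k : ℝ) - 2 = 2 * (k - 1) by ring]
    field_simp
  have h2 : ((q : ℝ) ^ (1 - 2 / ((k : ℝ) - 1))) ^ (k - 1) = (q : ℝ) ^ (k - 3) := by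
    rw [← Real.rpow_natCast, ← Real.rpow_natCast, ← Real.rpow_mul (Nat.cast_nonneg q), hcast1,
      hcast3]
    congr 1
    field_simp
    ring
  have h3 : (Real.log e ^ (-(1 : ℝ) / ((k : ℝ) - 1))) ^ (k - 1) = (Real.log e)⁻¹ := by
    rw [← Real.rpow_natCast, ← Real.rpow_mul hlog.le, hcast1, div_mul_cancel₀ _ hk1,
      Real.rpow_neg_one]
  rw [mul_pow, mul_pow, mul_pow, h1, h2, h3]
  field_simp

/-- For every `k ≥ 3` there are `c > 0` and `q₀` such that for all `q ≥ q₀` and all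
`e > q^(2k+2)` there is a `1`-`(q,k)`-system with exactly `e` `q`-cliques whose chromatic
number is at least `c · e^(1/(2k-2)) · q^(1-2/(k-1)) · (log e)^(-1/(k-1))`. -/
theorem stmt7 (k : ℕ) (hk : 3 ≤ k) :
    ∃ c : ℝ, 0 < c ∧ ∃ q₀ : ℕ, ∀ q : ℕ, q₀ ≤ q → ∀ e : ℕ, q ^ (2 * k + 2) < e →
      ∃ (N : ℕ) (𝒜 : Finset (Finset (Fin N))),
        IsSystem 1 q 𝒜 ∧ 𝒜.card = e ∧
        ∀ n : ℕ, SysColorable k n 𝒜 →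
          c * (e : ℝ) ^ ((1 : ℝ) / (2 * (k : ℝ) - 2)) *
              (q : ℝ) ^ (1 - 2 / ((k : ℝ) - 1)) *
              Real.log e ^ (-(1 : ℝ) / ((k : ℝ) - 1)) ≤ n := by
  have hk0 : (0 : ℝ) < k := by exact_mod_cast (by omega : 0 < k)
  obtain ⟨c, hc0, hc⟩ : ∃ c : ℝ, 0 < c ∧ c * (16 * (2 * k) ^ k) = 1 :=
    ⟨(16 * (2 * k) ^ k)⁻¹, by positivity, inv_mul_cancel₀ (by positivity)⟩
  set C : ℝ := 200 * (k : ℝ) ^ 4 + 4 * (4 / c) ^ (k - 1) with hC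
  have hC0 : 0 < C := by positivity
  obtain ⟨s₀, hs₀⟩ : ∃ s₀ : ℕ, ∀ s : ℕ, s₀ ≤ s → C * Real.log s ≤ √s := by
    have h1 := (isLittleO_log_rpow_atTop (r := 1 / 2) (by norm_num)).bound (inv_pos.2 hC0)
    obtain ⟨s₀, hs₀⟩ := Filter.eventually_atTop.1 (tendsto_natCast_atTop_atTop.eventually h1)
    refine ⟨s₀, fun s hs => ?_⟩
    have h2 := hs₀ s hs
    rw [← Real.sqrt_eq_rpow, Real.norm_of_nonneg (Real.sqrt_nonneg _)] at h2
    have h3 := (le_abs_self _).trans h2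
    rwa [← div_eq_inv_mul, le_div_iff₀' hC0] at h3
  refine ⟨c, hc0, max (100 * k) s₀, fun q hq e he => ?_⟩
  have hqk : 100 * k ≤ q := (le_max_left _ _).trans hq
  have hqs : s₀ ≤ q := (le_max_right _ _).trans hq
  have hq0 : 0 < q := by omega
  have he1 : 1 < e := lt_of_le_of_lt (Nat.one_le_pow _ _ hq0) he
  have hes : e < (Nat.sqrt e + 1) ^ 2 := Nat.lt_succ_sqrt' e
  have hse : (Nat.sqrt e + 1) ^ 2 ≤ 4 * e := by
    have h1 : 0 < Nat.sqrt e := Nat.sqrt_pos.2 (by omega)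
    have h2 := Nat.sqrt_le' e
    nlinarith
  set s := Nat.sqrt e + 1
  have hqs1 : q ^ (k + 1) ≤ s := by
    refine le_of_lt (lt_of_pow_lt_pow_left₀ 2 (Nat.zero_le _) ?_)
    rw [← pow_mul, show (k + 1) * 2 = 2 * k + 2 by ring]
    exact he.trans hes
  have hs4 : q ^ 4 ≤ s := (Nat.pow_le_pow_right hq0 (by omega)).trans hqs1
  have hs : s₀ ≤ s := hqs.trans ((Nat.le_self_pow (by omega) q).trans hqs1)
  have hlog : 0 < Real.log e := Real.log_pos (by exact_mod_cast he1)
  obtain ⟨N, m, hN, hm, hmB, hmN, h1, h2, h3⟩ := numerical_conditions hk hqk hs4 hes hse c _ hc0 hc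
    (by positivity) (lower_bound_pow hk hq0 he1 c) (hs₀ s hs)
  obtain ⟨𝒜, hsys, hcard, hhit⟩ :=
    exists_system_hitting (by omega) (by omega) hm hmN h1 h2 h3
  exact ⟨N, 𝒜, hsys, hcard, fun n hn => le_of_sysColorable hN hmB hhit hn⟩
end
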